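/- arXiv:2305.05219 — 3 statements merged into one kernel-verified Lean document; each statement's English description precedes it below -/
import Mathlib

section
/- Hilbert's finiteness theorem: let K be a field of characteristic zero and let a finite group G act linearly on K^n, hence on K[X_1, …, X_n] by f^g := f ∘ ρ(g^{-1}). Then the invariant subalgebra K[X_1, …, X_n]^G is generated as a K-algebra by finitely many homogeneous invariant polynomials; i.e. there exist homogeneous invariants π_1, …, π_m such that every invariant polynomial is a polynomial in π_1, …, π_m. -/
open MvPolynomial

/-- The action of an invertible matrix `M` on polynomials by linear change of variables:
`X_i ↦ Σ_j M i j • X_j`.  For a representation `ρ : G →* GLₙ(K)`, the polynomial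
`f^g := polyAct (ρ g⁻¹) f` satisfies `(f^g)(x) = f(ρ(g⁻¹) x)`. -/
noncomputable def polyAct {K : Type*} [CommSemiring K] {n : ℕ}
    (M : Matrix (Fin n) (Fin n) K) :
    MvPolynomial (Fin n) K →ₐ[K] MvPolynomial (Fin n) K :=
  MvPolynomial.aeval (fun i => ∑ j, M i j • MvPolynomial.X j)

theorem polyAct_polyAct {K : Type*} [CommSemiring K] {n : ℕ}
    (M N : Matrix (Fin n) (Fin n) K) (f : MvPolynomial (Fin n) K) :
    polyAct M (polyAct N f) = polyAct (N * M) f := by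
  have h : (polyAct M).comp (polyAct N) = polyAct (N * M) := by
    apply MvPolynomial.algHom_ext
    intro i
    simp only [polyAct, AlgHom.comp_apply, aeval_X, map_sum, map_smul, Matrix.mul_apply,
      Finset.smul_sum, Finset.sum_smul, smul_smul]
    exact Finset.sum_comm
  exact DFunLike.congr_fun h f

theorem polyAct_one {K : Type*} [CommSemiring K] {n : ℕ} (f : MvPolynomial (Fin n) K) :
    polyAct (1 : Matrix (Fin n) (Fin n) K) f = f := by
  have h : polyAct (1 : Matrix (Fin n) (Fin n) K) = AlgHom.id K _ := by
    apply MvPolynomial.algHom_ext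
    intro i
    simp [polyAct, Matrix.one_apply, ite_smul]
  simp [h]

theorem polyAct_isHomogeneous {K : Type*} [CommSemiring K] {n : ℕ}
    (M : Matrix (Fin n) (Fin n) K) {f : MvPolynomial (Fin n) K} {d : ℕ}
    (hf : f.IsHomogeneous d) : (polyAct M f).IsHomogeneous d := by
  have := hf.aeval (S := K) (n := 1) (fun i => ∑ j, M i j • MvPolynomial.X j) (by
    intro i
    apply MvPolynomial.IsHomogeneous.sum
    intro j _
    exact (homogeneousSubmodule (Fin n) K 1).smul_mem _ (isHomogeneous_X _ j))
  rwa [one_mul] at this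

theorem homogeneousComponent_polyAct {K : Type*} [CommSemiring K] {n : ℕ}
    (M : Matrix (Fin n) (Fin n) K) (f : MvPolynomial (Fin n) K) (d : ℕ) :
    homogeneousComponent d (polyAct M f) = polyAct M (homogeneousComponent d f) := by
  conv_lhs => rw [← sum_homogeneousComponent f]
  conv_rhs => rw [← sum_homogeneousComponent f]
  simp only [map_sum]
  refine Finset.sum_congr rfl fun i _ => ?_
  have h := homogeneousComponent_isHomogeneous i f
  rw [homogeneousComponent_of_mem (m := d) (polyAct_isHomogeneous M h),
    homogeneousComponent_of_mem (m := d) h]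
  split_ifs <;> simp

/-- The action of `G` on polynomials, as a `MulSemiringAction`. -/
noncomputable abbrev polyMulSemiringAction {K : Type*} [Field K] {n : ℕ} {G : Type*} [Group G]
    (ρ : G →* (Matrix (Fin n) (Fin n) K)ˣ) : MulSemiringAction G (MvPolynomial (Fin n) K) where
  smul g f := polyAct (↑(ρ g⁻¹)) f
  one_smul f := by
    change polyAct (↑(ρ (1 : G)⁻¹)) f = f
    simp [polyAct_one]
  mul_smul g h f := by
    change polyAct (↑(ρ (g * h)⁻¹)) f = polyAct (↑(ρ g⁻¹)) (polyAct (↑(ρ h⁻¹)) f)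
    rw [polyAct_polyAct, mul_inv_rev, map_mul, Units.val_mul]
  smul_zero g := map_zero (polyAct (ρ g⁻¹ : Matrix (Fin n) (Fin n) K))
  smul_add g a b := map_add (polyAct (ρ g⁻¹ : Matrix (Fin n) (Fin n) K)) a b
  smul_one g := map_one (polyAct (ρ g⁻¹ : Matrix (Fin n) (Fin n) K))
  smul_mul g a b := map_mul (polyAct (ρ g⁻¹ : Matrix (Fin n) (Fin n) K)) a b

/-- The subalgebra of invariants. -/
noncomputable def polyInvariants {K : Type*} [Field K] {n : ℕ} {G : Type*} [Group G]
    (ρ : G →* (Matrix (Fin n) (Fin n) K)ˣ) : Subalgebra K (MvPolynomial (Fin n) K) where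
  carrier := {f | ∀ g : G, polyAct (↑(ρ g⁻¹)) f = f}
  mul_mem' ha hb g := by rw [map_mul, ha g, hb g]
  add_mem' ha hb g := by rw [map_add, ha g, hb g]
  algebraMap_mem' r g := AlgHom.commutes _ r

theorem polyInvariants_fg {K : Type*} [Field K] {n : ℕ} {G : Type*} [Group G] [Finite G]
    (ρ : G →* (Matrix (Fin n) (Fin n) K)ˣ) : (polyInvariants ρ).FG := by
  let _ := polyMulSemiringAction ρ
  have hinv : Algebra.IsInvariant (polyInvariants ρ) (MvPolynomial (Fin n) K) G :=
    ⟨fun b hb => ⟨⟨b, hb⟩, rfl⟩⟩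
  have hint : Algebra.IsIntegral (polyInvariants ρ) (MvPolynomial (Fin n) K) :=
    Algebra.IsInvariant.isIntegral _ _ G
  have hft : Algebra.FiniteType (polyInvariants ρ) (MvPolynomial (Fin n) K) :=
    Algebra.FiniteType.of_restrictScalars_finiteType K _ _
  have hfin : Module.Finite (polyInvariants ρ) (MvPolynomial (Fin n) K) :=
    Algebra.IsIntegral.finite
  have hK : Algebra.FiniteType K (MvPolynomial (Fin n) K) := inferInstance
  exact (Subalgebra.fg_top _).1
    (fg_of_fg_of_fg K (polyInvariants ρ) (MvPolynomial (Fin n) K) hK.out hfin.fg_top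
      Subtype.val_injective)

/-- **Hilbert's finiteness theorem.**  Let `K` be a field of characteristic zero and let a
finite group `G` act linearly on `K^n` (via `ρ : G →* GLₙ(K)`), hence on `K[X_1,…,X_n]` by
`f^g := f ∘ ρ(g⁻¹)`.  Then the invariant subalgebra `K[X]^G` is generated, as a
`K`-algebra, by finitely many homogeneous invariant polynomials. -/
theorem hilbert_finiteness {K : Type*} [Field K] [CharZero K] {n : ℕ}
    {G : Type*} [Group G] [Finite G]
    (ρ : G →* (Matrix (Fin n) (Fin n) K)ˣ) :
    ∃ (m : ℕ) (π : Fin m → MvPolynomial (Fin n) K),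
      (∀ i, (∀ g : G, polyAct (↑(ρ g⁻¹)) (π i) = π i) ∧ ∃ d, (π i).IsHomogeneous d) ∧
      ∀ f : MvPolynomial (Fin n) K, (∀ g : G, polyAct (↑(ρ g⁻¹)) f = f) →
        f ∈ Algebra.adjoin K (Set.range π) := by
  obtain ⟨t, ht⟩ := polyInvariants_fg ρ
  let S : Set (MvPolynomial (Fin n) K) :=
    ⋃ f ∈ t, Set.image (fun d => homogeneousComponent d f) (Finset.range (f.totalDegree + 1) : Set ℕ)
  have hS : S.Finite := t.finite_toSet.biUnion fun f _ => (Finset.finite_toSet _).image _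
  obtain ⟨m, π, hπ⟩ := hS.fin_embedding
  refine ⟨m, π, fun i => ?_, fun f hf => ?_⟩
  · have hi : π i ∈ S := hπ ▸ Set.mem_range_self i
    simp only [S, Set.mem_iUnion] at hi
    obtain ⟨f, hft, d, -, hd⟩ := hi
    have hfinv : f ∈ polyInvariants ρ := ht ▸ Algebra.subset_adjoin hft
    rw [← hd]
    refine ⟨fun g => ?_, d, homogeneousComponent_isHomogeneous d f⟩
    change polyAct _ (homogeneousComponent d f) = homogeneousComponent d f
    rw [← homogeneousComponent_polyAct, hfinv g]
  · have hfmem : f ∈ polyInvariants ρ := hf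
    rw [← ht] at hfmem
    rw [hπ]
    refine Algebra.adjoin_le (fun p hp => ?_) hfmem
    rw [← sum_homogeneousComponent p]
    refine Subalgebra.sum_mem _ fun d hd => Algebra.subset_adjoin ?_
    simp only [S, Set.mem_iUnion]
    exact ⟨p, hp, d, hd, rfl⟩
end

section
/- Shephard–Todd–Chevalley theorem: let G be a finite subgroup of GL_n(ℝ) acting on V = ℝ^n and hence on ℝ[V] = ℝ[X_1, …, X_n]. The following are equivalent: (1) G is a reflection group, i.e. G is generated by reflections; (2) the invariant ring ℝ[V]^G is a polynomial algebra, i.e. it is generated as an ℝ-algebra by n algebraically independent homogeneous polynomials; (3) ℝ[V] is a free module over ℝ[V]^G. -/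
open MvPolynomial

/-- A matrix is a reflection if it is not the identity and its fixed-point space
`ker (A - id)` is a hyperplane. -/
def IsReflection {n : ℕ} (A : Matrix (Fin n) (Fin n) ℝ) : Prop :=
  A ≠ 1 ∧ Module.finrank ℝ
    (LinearMap.ker (Matrix.toLin' A - (LinearMap.id : (Fin n → ℝ) →ₗ[ℝ] Fin n → ℝ))) = n - 1

/-- The subalgebra of `G`-invariant polynomials, for the action `f^g := f ∘ ρ(g⁻¹)`. -/
noncomputable def invariantSubalgebra {n : ℕ} {G : Type*} [Group G]
    (ρ : G →* (Matrix (Fin n) (Fin n) ℝ)ˣ) : Subalgebra ℝ (MvPolynomial (Fin n) ℝ) where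
  carrier := {f | ∀ g : G, polyAct (↑(ρ g⁻¹)) f = f}
  mul_mem' := fun {a b} ha hb g => by rw [map_mul, ha g, hb g]
  one_mem' := fun g => map_one _
  add_mem' := fun {a b} ha hb g => by rw [map_add, ha g, hb g]
  zero_mem' := fun g => map_zero _
  algebraMap_mem' := fun r g => (polyAct _).commutes r


namespace STC

/-- The polynomial ring `ℝ[X_1, …, X_n]`. -/
abbrev Pol (n : ℕ) := MvPolynomial (Fin n) ℝ

/-- The general linear group, as units of the matrix ring. -/
abbrev GLn (n : ℕ) := (Matrix (Fin n) (Fin n) ℝ)ˣ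

variable {n : ℕ}

lemma polyAct_X (M : Matrix (Fin n) (Fin n) ℝ) (i : Fin n) :
    polyAct M (X i) = ∑ j, M i j • (X j : Pol n) := by
  simp [polyAct]

lemma polyAct_comp (M N : Matrix (Fin n) (Fin n) ℝ) :
    (polyAct M).comp (polyAct N) = polyAct (N * M) := by
  apply MvPolynomial.algHom_ext
  intro i
  simp only [AlgHom.comp_apply, polyAct_X, map_sum, map_smul, Finset.smul_sum, Matrix.mul_apply,
    Finset.sum_smul, smul_smul]
  rw [Finset.sum_comm]

lemma polyAct_one : polyAct (1 : Matrix (Fin n) (Fin n) ℝ) = AlgHom.id ℝ (Pol n) := by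
  apply MvPolynomial.algHom_ext
  intro i
  simp [polyAct_X, Matrix.one_apply]

/-- The action of a matrix on polynomials, as a monoid homomorphism. -/
noncomputable def act : GLn n →* (Pol n →ₐ[ℝ] Pol n) where
  toFun g := polyAct (↑(g⁻¹))
  map_one' := by rw [inv_one, Units.val_one]; exact polyAct_one
  map_mul' g h := by
    rw [mul_inv_rev, Units.val_mul, ← polyAct_comp]; rfl

lemma act_mul (g h : GLn n) (f : Pol n) : act (g * h) f = act g (act h f) := by
  rw [map_mul]; rfl

lemma act_one (f : Pol n) : act (1 : GLn n) f = f := by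
  rw [map_one]; rfl

lemma act_inv_act (g : GLn n) (f : Pol n) : act g⁻¹ (act g f) = f := by
  rw [← act_mul, inv_mul_cancel, act_one]

lemma act_act_inv (g : GLn n) (f : Pol n) : act g (act g⁻¹ f) = f := by
  rw [← act_mul, mul_inv_cancel, act_one]

lemma act_injective (g : GLn n) : Function.Injective (act g) := fun a b h => by
  rw [← act_inv_act g a, h, act_inv_act]

/-- The ring of invariants. -/
noncomputable abbrev Inv (H : Subgroup (GLn n)) : Subalgebra ℝ (Pol n) := invariantSubalgebra H.subtype

lemma mem_Inv {H : Subgroup (GLn n)} {f : Pol n} : f ∈ Inv H ↔ ∀ g ∈ H, act g f = f := by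
  constructor
  · intro h g hg
    exact h ⟨g, hg⟩
  · intro h g
    exact h g.1 g.2

lemma act_X_isHomogeneous (g : GLn n) (i : Fin n) : (act g (X i)).IsHomogeneous 1 := by
  change (polyAct _ (X i)).IsHomogeneous 1
  rw [polyAct_X]
  apply IsHomogeneous.sum
  intro j _
  rw [MvPolynomial.smul_eq_C_mul]
  exact isHomogeneous_C_mul_X _ _

lemma act_isHomogeneous (g : GLn n) {f : Pol n} {d : ℕ} (hf : f.IsHomogeneous d) :
    (act g f).IsHomogeneous d := by
  have : act g f = MvPolynomial.aeval (fun i => act g (X i)) f := by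
    congr 1
    apply MvPolynomial.algHom_ext
    intro i
    simp
  rw [this]
  simpa using hf.aeval (fun i => act g (X i)) (n := 1) (fun i => act_X_isHomogeneous g i)

/-- Homogeneous component of a product with a homogeneous element. -/
lemma hc_mul {σ : Type*} {r s : MvPolynomial σ ℝ} {e : ℕ} (hr : r.IsHomogeneous e) (k : ℕ) :
    homogeneousComponent k (r * s) =
      if e ≤ k then r * homogeneousComponent (k - e) s else 0 := by
  conv_lhs => rw [← sum_homogeneousComponent s, Finset.mul_sum, map_sum]
  have h1 : ∀ i, homogeneousComponent k (r * homogeneousComponent i s) =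
      if e + i = k then r * homogeneousComponent i s else 0 := by
    intro i
    have := (hr.mul (homogeneousComponent_isHomogeneous i s))
    rw [homogeneousComponent_of_mem ((mem_homogeneousSubmodule _ _).2 this)]
    simp only [eq_comm]
  simp only [h1]
  split_ifs with hek
  · rw [Finset.sum_eq_single (k - e)]
    · rw [if_pos (by omega)]
    · intro b _ hb
      rw [if_neg (by omega)]
    · intro hb
      rw [if_pos (by omega), homogeneousComponent_eq_zero, mul_zero]
      simp at hb; omega
  · apply Finset.sum_eq_zero
    intro i _
    rw [if_neg (by omega)]

lemma hc_mul_add {σ : Type*} {r s : MvPolynomial σ ℝ} {e : ℕ} (hr : r.IsHomogeneous e) (m : ℕ) :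
    homogeneousComponent (e + m) (r * s) = r * homogeneousComponent m s := by
  rw [hc_mul hr, if_pos (by omega), Nat.add_sub_cancel_left]

lemma hc_act (g : GLn n) (f : Pol n) (k : ℕ) :
    homogeneousComponent k (act g f) = act g (homogeneousComponent k f) := by
  conv_lhs => rw [← sum_homogeneousComponent f, map_sum, map_sum]
  have h1 : ∀ i, homogeneousComponent k (act g (homogeneousComponent i f)) =
      if k = i then act g (homogeneousComponent i f) else 0 := by
    intro i
    have := act_isHomogeneous g (homogeneousComponent_isHomogeneous i f)
    rw [homogeneousComponent_of_mem ((mem_homogeneousSubmodule _ _).2 this)]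
    
  simp only [h1]
  rw [Finset.sum_ite_eq]
  split_ifs with h
  · rfl
  · rw [homogeneousComponent_eq_zero, map_zero]
    simp at h; omega

lemma hc_mem_Inv {H : Subgroup (GLn n)} {f : Pol n} (hf : f ∈ Inv H) (k : ℕ) :
    homogeneousComponent k f ∈ Inv H := by
  rw [mem_Inv] at *
  intro g hg
  rw [← hc_act, hf g hg]

lemma hc_mem_span {σ : Type*} {T : Set (MvPolynomial σ ℝ)} (hT : ∀ t ∈ T, ∃ d, t.IsHomogeneous d)
    {f : MvPolynomial σ ℝ} (hf : f ∈ Ideal.span T) (k : ℕ) :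
    homogeneousComponent k f ∈ Ideal.span T := by
  classical
  let _ : GradedAlgebra (homogeneousSubmodule σ ℝ) := MvPolynomial.gradedAlgebra
  refine homogeneousComponent_mem_of_mem ?_ hf k
  apply Ideal.homogeneous_span
  intro x hx
  obtain ⟨d, hd⟩ := hT x hx
  exact ⟨d, hd⟩

/-- Reynolds operator. -/
noncomputable def rey (H : Subgroup (GLn n)) [Fintype H] (f : Pol n) : Pol n :=
  (Fintype.card H : ℝ)⁻¹ • ∑ g : H, act g.1 f

section rey
variable (H : Subgroup (GLn n)) [Fintype H]

lemma rey_mem (f : Pol n) : rey H f ∈ Inv H := by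
  rw [mem_Inv]
  intro g hg
  rw [rey, map_smul, map_sum]
  congr 1
  simp only [← act_mul]
  exact Fintype.sum_equiv (Equiv.mulLeft (⟨g, hg⟩ : H)) _ _ (fun x => rfl)

lemma rey_of_mem {f : Pol n} (hf : f ∈ Inv H) : rey H f = f := by
  rw [mem_Inv] at hf
  rw [rey, Finset.sum_congr rfl (fun g _ => hf g.1 g.2)]
  simp only [Finset.sum_const, Finset.card_univ]
  rw [← Nat.cast_smul_eq_nsmul ℝ, smul_smul, inv_mul_cancel₀, one_smul]
  exact_mod_cast Fintype.card_ne_zero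

lemma rey_add (a b : Pol n) : rey H (a + b) = rey H a + rey H b := by
  simp [rey, Finset.sum_add_distrib]

lemma rey_zero : rey H 0 = 0 := by simp [rey]

lemma rey_mul {r : Pol n} (hr : r ∈ Inv H) (a : Pol n) : rey H (r * a) = r * rey H a := by
  rw [mem_Inv] at hr
  simp only [rey, map_mul]
  rw [Finset.sum_congr rfl (fun g _ => by rw [hr g.1 g.2]), ← Finset.mul_sum, mul_smul_comm]

lemma rey_isHomogeneous {f : Pol n} {d : ℕ} (hf : f.IsHomogeneous d) :
    (rey H f).IsHomogeneous d := by
  rw [rey, MvPolynomial.smul_eq_C_mul]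
  exact (IsHomogeneous.sum _ _ _ (fun g _ => act_isHomogeneous g.1 hf)).C_mul _

lemma rey_sum {ι : Type*} (s : Finset ι) (f : ι → Pol n) :
    rey H (∑ i ∈ s, f i) = ∑ i ∈ s, rey H (f i) := by
  classical
  induction s using Finset.induction_on with
  | empty => simp [rey_zero]
  | insert a s ha ih => rw [Finset.sum_insert ha, Finset.sum_insert ha, rey_add, ih]

end rey

/-- Homogeneous invariants of positive degree. -/
def Rp (H : Subgroup (GLn n)) : Set (Pol n) := {f | f ∈ Inv H ∧ ∃ d, 0 < d ∧ f.IsHomogeneous d}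

/-- The Hilbert ideal. -/
noncomputable def HI (H : Subgroup (GLn n)) : Ideal (Pol n) := Ideal.span (Rp H)

lemma mem_HI_of_constantCoeff {H : Subgroup (GLn n)} {f : Pol n} (hf : f ∈ Inv H)
    (h0 : constantCoeff f = 0) : f ∈ HI H := by
  rw [← sum_homogeneousComponent f]
  apply Ideal.sum_mem
  intro i _
  rcases Nat.eq_zero_or_pos i with rfl | hi
  · rw [homogeneousComponent_zero, ← constantCoeff_eq, h0]; simp
  · exact Ideal.subset_span ⟨hc_mem_Inv hf i, i, hi, homogeneousComponent_isHomogeneous _ _⟩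

/-- The key property of Chevalley, essentially flatness. -/
def PP (H : Subgroup (GLn n)) : Prop :=
  ∀ T : Set (Pol n), (∀ t ∈ T, t ∈ Inv H ∧ ∃ d, t.IsHomogeneous d) →
    ∀ r ∈ Inv H, ∀ e, r.IsHomogeneous e → ∀ s : Pol n, r * s ∈ Ideal.span T →
      r ∉ Ideal.span T → s ∈ HI H

/-- Maps linear over the invariants preserve ideals generated by invariants. -/
lemma map_mem_span {H : Subgroup (GLn n)} (φ : Pol n → Pol n) (hadd : ∀ a b, φ (a + b) = φ a + φ b)
    (hmul : ∀ r ∈ Inv H, ∀ a, φ (r * a) = r * φ a) {T : Set (Pol n)} (hT : ∀ t ∈ T, t ∈ Inv H)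
    {f : Pol n} (hf : f ∈ Ideal.span T) : φ f ∈ Ideal.span T := by
  have h0 : φ 0 = 0 := by simpa using hadd 0 0
  suffices h : ∀ a : Pol n, φ (a * f) ∈ Ideal.span T by simpa using h 1
  refine Submodule.span_induction (p := fun f _ => ∀ a : Pol n, φ (a * f) ∈ Ideal.span T)
    ?_ ?_ ?_ ?_ hf
  · intro t ht a
    rw [mul_comm, hmul t (hT t ht)]
    exact Ideal.mul_mem_right _ _ (Ideal.subset_span ht)
  · intro a; simp [h0]
  · intro x y _ _ hx hy a
    rw [mul_add, hadd]
    exact Ideal.add_mem _ (hx a) (hy a)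
  · intro c x _ hx a
    rw [smul_eq_mul, ← mul_assoc]
    exact hx _



lemma reflection_rank_one {A : Matrix (Fin n) (Fin n) ℝ} (hA : IsReflection A) :
    ∃ v c : Fin n → ℝ, ∀ i j, A i j = (1 : Matrix (Fin n) (Fin n) ℝ) i j + v i * c j := by
  obtain ⟨_, h⟩ := hA
  set φ := (Matrix.toLin' A - (LinearMap.id : (Fin n → ℝ) →ₗ[ℝ] Fin n → ℝ)) with hφ
  have h1 := LinearMap.finrank_range_add_finrank_ker φ
  rw [h] at h1
  have h2 : Module.finrank ℝ (LinearMap.range φ) ≤ 1 := by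
    simp at h1; omega
  obtain ⟨v, hv⟩ := finrank_le_one_iff.1 h2
  have : ∀ j : Fin n, ∃ c : ℝ, c • (v : Fin n → ℝ) = φ (Pi.single j 1) := by
    intro j
    obtain ⟨c, hc⟩ := hv ⟨φ (Pi.single j 1), LinearMap.mem_range_self _ _⟩
    exact ⟨c, congrArg Subtype.val hc⟩
  choose c hc using this
  refine ⟨v, c, fun i j => ?_⟩
  have := congrFun (hc j) i
  simp [hφ, Matrix.toLin'_apply, Pi.single_apply] at this
  rw [Matrix.one_apply]
  linarith

lemma exists_root {A : Matrix (Fin n) (Fin n) ℝ} (hA : IsReflection A) :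
    ∃ α : Pol n, α ≠ 0 ∧ α.IsHomogeneous 1 ∧ ∀ f, α ∣ polyAct A f - f := by
  obtain ⟨v, c, hvc⟩ := reflection_rank_one hA
  have key : ∀ i, polyAct A (X i) - X i = (∑ j, C (c j) * X j : Pol n) * C (v i) := by
    intro i
    rw [polyAct_X, Finset.sum_mul]
    have : (X i : Pol n) = ∑ j, (1 : Matrix (Fin n) (Fin n) ℝ) i j • (X j : Pol n) := by
      rw [← polyAct_X, polyAct_one]; rfl
    rw [this, ← Finset.sum_sub_distrib]
    apply Finset.sum_congr rfl
    intro j _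
    rw [hvc i j, add_smul, add_sub_cancel_left, MvPolynomial.smul_eq_C_mul, C_mul]
    ring
  refine ⟨∑ j, C (c j) * X j, ?_, ?_, ?_⟩
  · intro h0
    apply hA.1
    ext i j
    rw [hvc i j]
    have : c j = 0 := by
      have := congrArg (coeff (Finsupp.single j 1)) h0
      simpa [coeff_sum, coeff_C_mul, coeff_X, Finsupp.single_left_inj] using this
    simp [this]
  · exact IsHomogeneous.sum _ _ _ (fun j _ => isHomogeneous_C_mul_X _ _)
  · intro f
    induction f using MvPolynomial.induction_on with
    | C a => simp [polyAct]
    | add p q hp hq =>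
      rw [map_add, add_sub_add_comm]
      exact dvd_add hp hq
    | mul_X p i hp =>
      rw [map_mul]
      have : polyAct A p * polyAct A (X i) - p * X i =
        (polyAct A p - p) * polyAct A (X i) + p * (polyAct A (X i) - X i) := by ring
      rw [this]
      refine dvd_add (Dvd.dvd.mul_right hp _) (Dvd.dvd.mul_left ?_ _)
      rw [key]
      exact Dvd.intro _ rfl

lemma act_mem_HI {H : Subgroup (GLn n)} {g : GLn n} (hg : g ∈ H) {f : Pol n} (hf : f ∈ HI H) :
    act g f ∈ HI H := by
  refine map_mem_span (H := H) (fun f => act g f) (fun a b => map_add _ _ _) ?_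
    (fun t ht => ht.1) hf
  intro r hr a
  rw [map_mul, mem_Inv.1 hr g hg]

lemma key_homogeneous (H : Subgroup (GLn n)) [Finite H]
    (hH : H = Subgroup.closure {g : GLn n | g ∈ H ∧ IsReflection (↑g : Matrix (Fin n) (Fin n) ℝ)})
    (T : Set (Pol n)) (hT : ∀ t ∈ T, t ∈ Inv H) (r : Pol n) (hr : r ∈ Inv H)
    (hrT : r ∉ Ideal.span T) (d : ℕ) :
    ∀ s : Pol n, s.IsHomogeneous d → r * s ∈ Ideal.span T → s ∈ HI H := by
  have := Fintype.ofFinite H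
  have hrey : ∀ s, r * s ∈ Ideal.span T → r * rey H s ∈ Ideal.span T := by
    intro s hs
    rw [← rey_mul H hr]
    exact map_mem_span (rey H) (rey_add H) (fun r hr a => rey_mul H hr a) hT hs
  induction d with
  | zero =>
    intro s hs hrs
    have hsC : s = C (coeff 0 s) := by
      rw [← totalDegree_eq_zero_iff_eq_C]
      exact (totalDegree_zero_iff_isHomogeneous _).2 hs
    by_cases h0 : coeff 0 s = 0
    · rw [hsC, h0]; simp
    · exfalso
      apply hrT
      have : r = C (coeff 0 s)⁻¹ * (r * s) := by
        conv_rhs => rw [hsC]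
        rw [mul_comm r, ← mul_assoc, ← C_mul, coeff_C]
        simp [h0]
      rw [this]
      exact Ideal.mul_mem_left _ _ hrs
  | succ d ih =>
    intro s hs hrs
    have hall : ∀ g ∈ H, act g s - s ∈ HI H := by
      intro g hg
      rw [hH] at hg
      induction hg using Subgroup.closure_induction with
      | mem g hg =>
        obtain ⟨hgH, hgr⟩ := hg
        obtain ⟨α, hα0, hα1, hα⟩ := exists_root hgr
        have hα' : ∀ f, ∃ q, act g⁻¹ f - f = α * q := by
          intro f
          have := hα f
          change ∃ q, polyAct (↑(g⁻¹⁻¹) : Matrix (Fin n) (Fin n) ℝ) f - f = α * q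
          rw [inv_inv]
          exact this
        choose Δ hΔ using hα'
        have hadd : ∀ a b, Δ (a + b) = Δ a + Δ b := by
          intro a b
          apply mul_left_cancel₀ hα0
          rw [mul_add, ← hΔ, ← hΔ, ← hΔ, map_add]; ring
        have hmul : ∀ r ∈ Inv H, ∀ a, Δ (r * a) = r * Δ a := by
          intro r hr a
          apply mul_left_cancel₀ hα0
          rw [mul_left_comm, ← hΔ, ← hΔ, map_mul, mem_Inv.1 hr _ (H.inv_mem hgH)]; ring
        have hΔs : (Δ s).IsHomogeneous d := by
          have h1 : homogeneousComponent (1 + d) (α * Δ s) = α * Δ s := by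
            apply homogeneousComponent_eq_self
            rw [← hΔ, add_comm]
            exact (act_isHomogeneous _ hs).sub hs
          rw [hc_mul_add hα1] at h1
          rw [← mul_left_cancel₀ hα0 h1]
          exact homogeneousComponent_isHomogeneous _ _
        have h2 : Δ s ∈ HI H := by
          apply ih _ hΔs
          rw [← hmul r hr]
          exact map_mem_span Δ hadd hmul hT hrs
        have h3 : act g⁻¹ s - s ∈ HI H := by
          rw [hΔ]
          exact Ideal.mul_mem_left _ _ h2
        have h4 := act_mem_HI hgH h3
        rw [map_sub, act_act_inv] at h4
        rw [← neg_sub]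
        exact (Ideal.neg_mem_iff _).2 h4
      | one => rw [act_one, sub_self]; exact Ideal.zero_mem _
      | mul x y hx hy h1 h2 =>
        rw [← hH] at hx hy
        have := Ideal.add_mem _ (act_mem_HI hx h2) h1
        rwa [map_sub, ← act_mul, sub_add_sub_cancel] at this
      | inv x hx h1 =>
        rw [← hH] at hx
        have := act_mem_HI (H.inv_mem hx) h1
        rw [map_sub, act_inv_act] at this
        rw [← neg_sub]
        exact (Ideal.neg_mem_iff _).2 this
    have h5 : rey H s ∈ HI H :=
      Ideal.subset_span ⟨rey_mem H s, d + 1, Nat.succ_pos _, rey_isHomogeneous H hs⟩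
    have h6 : rey H s - s ∈ HI H := by
      have : rey H s - s = (Fintype.card H : ℝ)⁻¹ • ∑ g : H, (act g.1 s - s) := by
        rw [Finset.sum_sub_distrib, smul_sub, rey, Finset.sum_const, Finset.card_univ,
          ← Nat.cast_smul_eq_nsmul ℝ, smul_smul, inv_mul_cancel₀, one_smul]
        exact_mod_cast Fintype.card_ne_zero
      rw [this, MvPolynomial.smul_eq_C_mul]
      exact Ideal.mul_mem_left _ _ (Ideal.sum_mem _ (fun g _ => hall g.1 g.2))
    have := Ideal.sub_mem _ h5 h6
    rwa [sub_sub_cancel] at this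

lemma PP_of_reflection (H : Subgroup (GLn n)) [Finite H]
    (hH : H = Subgroup.closure
      {g : GLn n | g ∈ H ∧ IsReflection (↑g : Matrix (Fin n) (Fin n) ℝ)}) :
    PP H := by
  intro T hT r hr e hre s hs hrT
  rw [← sum_homogeneousComponent s]
  apply Ideal.sum_mem
  intro m _
  apply key_homogeneous H hH T (fun t ht => (hT t ht).1) r hr hrT m _
    (homogeneousComponent_isHomogeneous _ _)
  rw [← hc_mul_add hre]
  exact hc_mem_span (fun t ht => (hT t ht).2) hs _

lemma PP_of_free (H : Subgroup (GLn n)) (hfree : Module.Free (Inv H) (Pol n)) : PP H := by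
  intro T hT r hr e hre s hs hrT
  let b := Module.Free.chooseBasis (Inv H) (Pol n)
  rw [← b.linearCombination_repr s, Finsupp.linearCombination_apply]
  apply Ideal.sum_mem
  intro i _
  change ((b.repr s i : Inv H) : Pol n) * b i ∈ HI H
  apply Ideal.mul_mem_right
  apply mem_HI_of_constantCoeff (b.repr s i).2
  by_contra hne
  apply hrT
  have h1 : ((b.repr (r * s) i : Inv H) : Pol n) ∈ Ideal.span T := by
    refine map_mem_span (H := H) (fun f => ((b.repr f i : Inv H) : Pol n)) ?_ ?_
      (fun t ht => (hT t ht).1) hs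
    · intro a b; simp
    · intro r hr a
      have : r * a = (⟨r, hr⟩ : Inv H) • a := rfl
      simp only [this, map_smul, Finsupp.smul_apply]
      rfl
  have h2 : ((b.repr (r * s) i : Inv H) : Pol n) = r * ((b.repr s i : Inv H) : Pol n) := by
    have : r * s = (⟨r, hr⟩ : Inv H) • s := rfl
    simp only [this, map_smul, Finsupp.smul_apply]
    rfl
  rw [h2] at h1
  have h3 := hc_mem_span (fun t ht => (hT t ht).2) h1 (e + 0)
  rw [hc_mul_add hre, homogeneousComponent_zero, ← constantCoeff_eq] at h3
  have h4 := Ideal.mul_mem_right (C (constantCoeff ((b.repr s i : Inv H) : Pol n))⁻¹) _ h3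
  rwa [mul_assoc, ← C_mul, mul_inv_cancel₀ hne, C_1, mul_one] at h4



/-- An invariant in an ideal generated by invariants is a combination with invariant
coefficients. -/
lemma exists_inv_coeff (H : Subgroup (GLn n)) [Finite H] {ι : Type*} (F : Finset ι)
    (r : ι → Pol n) (hr : ∀ i ∈ F, r i ∈ Inv H) (a : Pol n) (ha : a ∈ Inv H)
    (h : a ∈ Ideal.span (r '' F)) :
    ∃ t : ι → Pol n, (∀ i, t i ∈ Inv H) ∧ a = ∑ i ∈ F, t i * r i := by
  have := Fintype.ofFinite H
  classical
  obtain ⟨c0, hc0⟩ := (Submodule.mem_span_image_finset_iff_exists_fun (Pol n)).1 h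
  obtain ⟨c, hc⟩ : ∃ c : ι → Pol n, ∑ i ∈ F, c i * r i = a := by
    refine ⟨fun i => if h : i ∈ F then c0 ⟨i, h⟩ else 0, ?_⟩
    rw [← hc0, ← Finset.sum_coe_sort]
    apply Finset.sum_congr rfl
    intro i _
    simp
  refine ⟨fun i => rey H (c i), fun i => rey_mem H _, ?_⟩
  rw [← rey_of_mem H ha, ← hc, rey_sum]
  apply Finset.sum_congr rfl
  intro i hi
  rw [mul_comm, rey_mul H (hr i hi), mul_comm]

/-- Elements independent modulo the Hilbert ideal are independent over the invariants
(with homogeneous coefficients). -/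
lemma indep_homogeneous (H : Subgroup (GLn n)) [Finite H] (hP : PP H) {ι : Type*}
    (F : Finset ι) : ∀ (r s : ι → Pol n), (∀ i ∈ F, r i ∈ Inv H) →
    (∀ i ∈ F, ∃ d, (r i).IsHomogeneous d) →
    (∀ c : ι → ℝ, ∑ i ∈ F, c i • s i ∈ HI H → ∀ i ∈ F, c i = 0) →
    ∑ i ∈ F, r i * s i = 0 → ∀ i ∈ F, r i = 0 := by
  classical
  induction F using Finset.induction_on with
  | empty => simp
  | insert b F hb ih =>
    intro r s hr hrd hs hsum
    rw [Finset.sum_insert hb] at hsum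
    have hrF : ∀ i ∈ F, r i ∈ Inv H := fun i hi => hr i (Finset.mem_insert_of_mem hi)
    have hne : s b ∉ HI H := by
      intro hmem
      have := hs (Pi.single b 1) ?_ b (Finset.mem_insert_self _ _)
      · simp at this
      · rw [Finset.sum_insert hb, Finset.sum_eq_zero]
        · simpa using hmem
        · intro i hi
          rw [Pi.single_eq_of_ne, zero_smul]
          rintro rfl; exact hb hi
    have hspan : r b ∈ Ideal.span (r '' F) := by
      by_contra hcon
      apply hne
      obtain ⟨e, he⟩ := hrd b (Finset.mem_insert_self _ _)
      refine hP (r '' F) ?_ (r b) (hr b (Finset.mem_insert_self _ _)) e he (s b) ?_ hcon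
      · rintro t ⟨i, hi, rfl⟩
        exact ⟨hrF i hi, hrd i (Finset.mem_insert_of_mem hi)⟩
      · rw [eq_neg_of_add_eq_zero_left hsum]
        rw [Ideal.neg_mem_iff]
        apply Ideal.sum_mem
        intro i hi
        exact Ideal.mul_mem_right _ _ (Ideal.subset_span ⟨i, hi, rfl⟩)
    obtain ⟨t, ht, hrb⟩ := exists_inv_coeff H F r hrF (r b) (hr b (Finset.mem_insert_self _ _)) hspan
    have hF : ∀ i ∈ F, r i = 0 := by
      apply ih r (fun i => s i + t i * s b) hrF (fun i hi => hrd i (Finset.mem_insert_of_mem hi))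
      · intro c hc i hi
        have h1 : ∑ i ∈ F, c i • s i + (∑ i ∈ F, c i * constantCoeff (t i)) • s b ∈ HI H := by
          have h2 : ∑ i ∈ F, c i • (s i + t i * s b) -
              (∑ i ∈ F, c i • s i + (∑ i ∈ F, c i * constantCoeff (t i)) • s b) ∈ HI H := by
            rw [Finset.sum_smul, ← Finset.sum_add_distrib, ← Finset.sum_sub_distrib]
            apply Ideal.sum_mem
            intro j _
            have : c j • (s j + t j * s b) - (c j • s j + (c j * constantCoeff (t j)) • s b) =
                (t j - C (constantCoeff (t j))) * (C (c j) * s b) := by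
              simp only [MvPolynomial.smul_eq_C_mul, C_mul]; ring
            rw [this]
            apply Ideal.mul_mem_right
            apply mem_HI_of_constantCoeff
            · exact (Inv H).sub_mem (ht j) ((Inv H).algebraMap_mem _)
            · simp
          have := Ideal.sub_mem _ hc h2
          rwa [sub_sub_cancel] at this
        have h3 := hs (Function.update c b (∑ i ∈ F, c i * constantCoeff (t i))) ?_ i
          (Finset.mem_insert_of_mem hi)
        · rwa [Function.update_of_ne] at h3
          rintro rfl; exact hb hi
        · rw [Finset.sum_insert hb, Function.update_self, add_comm]
          convert h1 using 2
          apply Finset.sum_congr rfl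
          intro j hj
          rw [Function.update_of_ne]
          rintro rfl; exact hb hj
      · rw [hrb, Finset.sum_mul, ← Finset.sum_add_distrib] at hsum
        rw [← hsum]
        apply Finset.sum_congr rfl
        intro i _; ring
    intro i hi
    rcases Finset.mem_insert.1 hi with rfl | hi
    · rw [hrb]
      exact Finset.sum_eq_zero (fun j hj => by rw [hF j hj, mul_zero])
    · exact hF i hi

lemma free_of_PP (H : Subgroup (GLn n)) [Finite H] (hP : PP H) :
    Module.Free (Inv H) (Pol n) := by
  classical
  -- choose monomials forming a basis modulo the Hilbert ideal
  let q : Pol n →ₗ[ℝ] (Pol n ⧸ (HI H)) := (Ideal.Quotient.mkₐ ℝ (HI H)).toLinearMap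
  have hq : ∀ f, q f = 0 ↔ f ∈ HI H := fun f => Ideal.Quotient.eq_zero_iff_mem
  let mon : (Fin n →₀ ℕ) → Pol n := fun m => monomial m 1
  obtain ⟨κ, a, -, hspan, hli⟩ := exists_linearIndependent' ℝ (fun m => q (mon m))
  have htop : Submodule.span ℝ (Set.range mon) = ⊤ := by
    rw [← (MvPolynomial.basisMonomials (Fin n) ℝ).span_eq, MvPolynomial.coe_basisMonomials]
  let e : κ → Pol n := fun k => mon (a k)
  have he : ∀ k, (e k).IsHomogeneous (a k).degree := fun k => isHomogeneous_monomial _ rfl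
  have hcomp : ((fun m => q (mon m)) ∘ a) = q ∘ e := rfl
  have hmap : Submodule.map q (Submodule.span ℝ (Set.range e)) = Submodule.map q ⊤ := by
    rw [Submodule.map_span, ← Set.range_comp, ← hcomp, hspan, ← htop, Submodule.map_span,
      ← Set.range_comp]
    rfl
  have hLI : LinearIndependent (Inv H) e := by
    rw [linearIndependent_iff']
    intro s g hg i₀ hi₀
    ext1
    rw [← sum_homogeneousComponent ((g i₀ : Inv H) : Pol n)]
    apply Finset.sum_eq_zero
    intro m _
    have key := indep_homogeneous H hP s
      (fun i => if (a i).degree ≤ (a i₀).degree + m then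
        homogeneousComponent ((a i₀).degree + m - (a i).degree) ((g i : Inv H) : Pol n) else 0) e
      ?_ ?_ ?_ ?_ i₀ hi₀
    · simpa using key
    · intro i _
      split_ifs
      · exact hc_mem_Inv (g i).2 _
      · exact (Inv H).zero_mem
    · intro i _
      split_ifs
      · exact ⟨_, homogeneousComponent_isHomogeneous _ _⟩
      · exact ⟨0, isHomogeneous_zero _ _ _⟩
    · intro c hc
      rw [← hq, map_sum] at hc
      simp only [map_smul] at hc
      exact linearIndependent_iff'.1 hli s c hc
    · have h1 := congrArg (homogeneousComponent ((a i₀).degree + m)) hg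
      rw [map_sum, map_zero] at h1
      refine Eq.trans ?_ h1
      apply Finset.sum_congr rfl
      intro i _
      have : g i • e i = e i * ((g i : Inv H) : Pol n) := by
        rw [mul_comm]; rfl
      rw [this, hc_mul (he i)]
      split_ifs <;> ring
  let M : Submodule (Inv H) (Pol n) := Submodule.span (Inv H) (Set.range e)
  have heM : ∀ k, e k ∈ M := fun k => Submodule.subset_span ⟨k, rfl⟩
  have hM : ∀ d, ∀ f : Pol n, f.IsHomogeneous d → f ∈ M := by
    intro d
    induction d using Nat.strong_induction_on with
    | _ d ih =>
    intro f hf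
    have h1 : q f ∈ Submodule.map q (Submodule.span ℝ (Set.range e)) := by
      rw [hmap]; exact ⟨f, trivial, rfl⟩
    obtain ⟨l, hl, hlf⟩ := h1
    have h2 : f - l ∈ HI H := by
      rw [← hq, map_sub, hlf, sub_self]
    have h3 : homogeneousComponent d l ∈ M := by
      have : Submodule.span ℝ (Set.range e) ≤
          (M.restrictScalars ℝ).comap (homogeneousComponent d) := by
        rw [Submodule.span_le]
        rintro _ ⟨k, rfl⟩
        change homogeneousComponent d (e k) ∈ M
        rw [homogeneousComponent_of_mem ((mem_homogeneousSubmodule _ _).2 (he k))]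
        split_ifs
        · exact heM k
        · exact M.zero_mem
      exact this hl
    have h4 : ∀ x ∈ HI H, ∀ c : Pol n, homogeneousComponent d (c * x) ∈ M := by
      intro x hx
      refine Submodule.span_induction
        (p := fun x _ => ∀ c : Pol n, homogeneousComponent d (c * x) ∈ M) ?_ ?_ ?_ ?_ hx
      · rintro t ⟨htI, k, hk, ht⟩ c
        rw [mul_comm, hc_mul ht]
        split_ifs
        · exact M.smul_mem ⟨t, htI⟩
            (ih (d - k) (by omega) _ (homogeneousComponent_isHomogeneous _ _))
        · exact M.zero_mem
      · intro c; simp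
      · intro x y _ _ hx hy c
        rw [mul_add, map_add]
        exact M.add_mem (hx c) (hy c)
      · intro b x _ hx c
        rw [smul_eq_mul, ← mul_assoc]
        exact hx _
    have h5 := M.add_mem h3 (h4 _ h2 1)
    rw [one_mul, ← map_add, add_sub_cancel, homogeneousComponent_eq_self hf] at h5
    exact h5
  refine Module.Free.of_basis (Module.Basis.mk hLI ?_)
  intro f _
  rw [← sum_homogeneousComponent f]
  exact M.sum_mem (fun i _ => hM i _ (homogeneousComponent_isHomogeneous _ _))



lemma chain_rule {ι A : Type*} [Fintype ι] [CommRing A] [Algebra ℝ A]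
    (D : Derivation ℝ A A) (f : ι → A) (h : MvPolynomial ι ℝ) :
    D (aeval f h) = ∑ i, aeval f (pderiv i h) * D (f i) := by
  classical
  induction h using MvPolynomial.induction_on with
  | C a => simp
  | add p q hp hq => simp only [map_add, hp, hq, add_mul, Finset.sum_add_distrib]
  | mul_X p j hp =>
    simp only [map_mul, Derivation.leibniz, hp, aeval_X, pderiv_X, smul_eq_mul, map_add, add_mul,
      Finset.sum_add_distrib, Finset.mul_sum]
    congr 1
    · rw [Finset.sum_eq_single j]
      · simp
      · intro b _ hb; simp [hb.symm]
      · simp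
    · exact Finset.sum_congr rfl (fun i _ => by ring)

section aevalgr
variable {ι : Type*} [Fintype ι] (f : ι → Pol n) (d : ι → ℕ)

lemma aeval_monomial_isHomogeneous (hf : ∀ i, (f i).IsHomogeneous (d i)) (m : ι →₀ ℕ) (c : ℝ) :
    (aeval f (monomial m c)).IsHomogeneous (Finsupp.weight d m) := by
  rw [aeval_monomial, Finsupp.prod_fintype _ _ (fun i => pow_zero _)]
  apply IsHomogeneous.C_mul
  have h2 : Finsupp.weight d m = ∑ i, d i * m i := by
    rw [Finsupp.weight_apply, Finsupp.sum_fintype _ _ (by simp)]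
    simp [mul_comm]
  rw [h2]
  exact IsHomogeneous.prod _ _ _ (fun i _ => (hf i).pow _)

lemma hc_aeval (hf : ∀ i, (f i).IsHomogeneous (d i)) (h : MvPolynomial ι ℝ) (D : ℕ) :
    homogeneousComponent D (aeval f h) = aeval f (weightedHomogeneousComponent d D h) := by
  classical
  induction h using MvPolynomial.induction_on' with
  | monomial m c =>
    rw [homogeneousComponent_of_mem
      ((mem_homogeneousSubmodule _ _).2 (aeval_monomial_isHomogeneous f d hf m c))]
    rw [weightedHomogeneousComponent_of_mem (n := Finsupp.weight d m)
      ((mem_weightedHomogeneousSubmodule ℝ d _ _).2 (isWeightedHomogeneous_monomial d m c rfl))]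
    split_ifs <;> simp
  | add p q hp hq => simp only [map_add, hp, hq]

lemma aeval_isHomogeneous (hf : ∀ i, (f i).IsHomogeneous (d i)) {h : MvPolynomial ι ℝ} {D : ℕ}
    (hh : h.IsWeightedHomogeneous d D) : (aeval f h).IsHomogeneous D := by
  have := hc_aeval f d hf h D
  rw [weightedHomogeneousComponent_eq_self hh] at this
  rw [← this]
  exact homogeneousComponent_isHomogeneous _ _

end aevalgr

lemma exists_min_gen {A ι : Type*} [CommRing A] [DecidableEq ι] (r : ι → A) (F : Finset ι) :
    ∃ J ⊆ F, Ideal.span (r '' J) = Ideal.span (r '' F) ∧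
      ∀ j ∈ J, r j ∉ Ideal.span (r '' (J.erase j : Finset ι)) := by
  let 𝒮 : Set (Finset ι) := {J | J ⊆ F ∧ Ideal.span (r '' J) = Ideal.span (r '' F)}
  obtain ⟨J, hJ, hmin⟩ := WellFounded.has_min (measure (Finset.card (α := ι))).wf 𝒮
    ⟨F, Finset.Subset.refl _, rfl⟩
  refine ⟨J, hJ.1, hJ.2, fun j hj hmem => ?_⟩
  refine hmin (J.erase j) ⟨(Finset.erase_subset _ _).trans hJ.1, ?_⟩ (Finset.card_erase_lt_of_mem hj)
  rw [← hJ.2]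
  apply le_antisymm
  · exact Ideal.span_mono (Set.image_mono (Finset.erase_subset _ _))
  · rw [Ideal.span_le]
    rintro _ ⟨i, hi, rfl⟩
    by_cases hij : i = j
    · rw [hij]; exact hmem
    · exact Ideal.subset_span ⟨i, by simpa [hij] using hi, rfl⟩

section gens
variable (H : Subgroup (GLn n)) [Finite H] {ι : Type*} [Fintype ι] (f : ι → Pol n) (d : ι → ℕ)

lemma adjoin_of_gens (hd : ∀ i, 0 < d i) (hf : ∀ i, (f i).IsHomogeneous (d i))
    (hinv : ∀ i, f i ∈ Inv H) (hspan : HI H = Ideal.span (Set.range f)) :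
    ∀ g ∈ Inv H, g ∈ Algebra.adjoin ℝ (Set.range f) := by
  have key : ∀ k, ∀ g ∈ Inv H, g.IsHomogeneous k → g ∈ Algebra.adjoin ℝ (Set.range f) := by
    intro k
    induction k using Nat.strong_induction_on with
    | _ k ih =>
    intro g hg hgk
    rcases Nat.eq_zero_or_pos k with rfl | hk
    · have hsC : g = C (coeff 0 g) := by
        rw [← totalDegree_eq_zero_iff_eq_C]
        exact (totalDegree_zero_iff_isHomogeneous _).2 hgk
      rw [hsC]
      exact Subalgebra.algebraMap_mem _ _
    · have h1 : g ∈ Ideal.span (f '' (Finset.univ : Finset ι)) := by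
        rw [Finset.coe_univ, Set.image_univ, ← hspan]
        exact Ideal.subset_span ⟨hg, k, hk, hgk⟩
      obtain ⟨t, ht, hgt⟩ := exists_inv_coeff H Finset.univ f (fun i _ => hinv i) g hg h1
      rw [← homogeneousComponent_eq_self hgk, hgt, map_sum]
      apply Subalgebra.sum_mem
      intro i _
      rw [mul_comm, hc_mul (hf i)]
      split_ifs
      · apply Subalgebra.mul_mem
        · exact Algebra.subset_adjoin ⟨i, rfl⟩
        · exact ih (k - d i) (by have := hd i; omega) _ (hc_mem_Inv (ht i) _)
            (homogeneousComponent_isHomogeneous _ _)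
      · exact Subalgebra.zero_mem _
  intro g hg
  rw [← sum_homogeneousComponent g]
  exact Subalgebra.sum_mem _ (fun i _ => key i _ (hc_mem_Inv hg i)
    (homogeneousComponent_isHomogeneous _ _))

lemma algIndep_of_gens (hP : PP H) (hd : ∀ i, 0 < d i) (hf : ∀ i, (f i).IsHomogeneous (d i))
    (hinv : ∀ i, f i ∈ Inv H) (hspan : HI H = Ideal.span (Set.range f))
    (hmin : ∀ i, f i ∉ Ideal.span (f '' {i}ᶜ)) : AlgebraicIndependent ℝ f := by
  classical
  have key : ∀ D, ∀ h : MvPolynomial ι ℝ, h.IsWeightedHomogeneous d D → aeval f h = 0 → h = 0 := by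
    intro D
    induction D using Nat.strong_induction_on with
    | _ D ih =>
    intro h hh h0
    by_contra hne
    have hpd : ∀ i, ∃ D', D' < D ∧ (pderiv i h).IsWeightedHomogeneous d D' ∨ pderiv i h = 0 := by
      intro i
      by_cases hi : d i ≤ D
      · exact ⟨D - d i, Or.inl ⟨by have := hd i; omega, hh.pderiv (by omega)⟩⟩
      · refine ⟨0, Or.inr ?_⟩
        ext m
        rw [coeff_pderiv, hh.coeff_eq_zero, zero_mul, coeff_zero]
        rw [map_add, Finsupp.weight_single]
        simp; omega
    let p : ι → Pol n := fun i => aeval f (pderiv i h)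
    have hpinv : ∀ i, p i ∈ Inv H := by
      intro i
      have : p i ∈ Algebra.adjoin ℝ (Set.range f) := by
        rw [Algebra.adjoin_range_eq_range_aeval]
        exact ⟨_, rfl⟩
      refine (Algebra.adjoin_le ?_ : Algebra.adjoin ℝ (Set.range f) ≤ Inv H) this
      rintro _ ⟨j, rfl⟩
      exact hinv j
    have hphom : ∀ i, ∃ k, (p i).IsHomogeneous k := by
      intro i
      obtain ⟨D', h1 | h1⟩ := hpd i
      · exact ⟨D', aeval_isHomogeneous f d hf h1.2⟩
      · exact ⟨0, by simp only [p, h1, map_zero]; exact isHomogeneous_zero _ _ _⟩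
    have hpne : ∃ i, p i ≠ 0 := by
      by_contra hall
      push Not at hall
      have hz : ∀ i, pderiv i h = 0 := by
        intro i
        obtain ⟨D', h1 | h1⟩ := hpd i
        · exact ih D' h1.1 _ h1.2 (hall i)
        · exact h1
      have he := hh.sum_weight_X_mul_pderiv
      simp only [hz, mul_zero, smul_zero, Finset.sum_const_zero] at he
      rcases Nat.eq_zero_or_pos D with rfl | hD
      · -- constant
        have hC : h = C (coeff 0 h) := by
          ext m
          rw [coeff_C]
          split_ifs with hm
          · rw [hm]
          · apply hh.coeff_eq_zero
            intro hw
            apply hm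
            have hnt : Finsupp.NonTorsionWeight ℕ d :=
              Finsupp.nonTorsionWeight_of ℕ d (fun i => (hd i).ne')
            have := (Finsupp.weight_eq_zero_iff_eq_zero d).1 hw
            exact this.symm
        rw [hC, aeval_C] at h0
        apply hne
        rw [hC]
        have := (algebraMap ℝ (Pol n)).injective (h0.trans (map_zero _).symm)
        rw [this, C_0]
      · apply hne
        have h2 := he.symm
        rw [← Nat.cast_smul_eq_nsmul ℝ] at h2
        rcases smul_eq_zero.1 h2 with h3 | h3
        · exact absurd (Nat.cast_eq_zero.1 h3) (by omega)
        · exact h3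
    obtain ⟨J, -, hJspan, hJmin⟩ := exists_min_gen p Finset.univ
    rw [Finset.coe_univ, Set.image_univ] at hJspan
    have hJne : J.Nonempty := by
      rw [Finset.nonempty_iff_ne_empty]
      rintro rfl
      obtain ⟨i, hi⟩ := hpne
      apply hi
      have : p i ∈ Ideal.span (Set.range p) := Ideal.subset_span ⟨i, rfl⟩
      rw [← hJspan] at this
      simpa using this
    obtain ⟨j₀, hj₀⟩ := hJne
    set Q := Ideal.span (p '' (J.erase j₀ : Finset ι)) with hQ
    have hγ : ∀ i, ∃ γ : Pol n, (i = j₀ → γ = 1) ∧ p i - γ * p j₀ ∈ Q := by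
      intro i
      by_cases hi : i = j₀
      · exact ⟨1, fun _ => rfl, by simp [hi]⟩
      · have h1 : p i ∈ Ideal.span (p '' J) := by
          rw [hJspan]; exact Ideal.subset_span ⟨i, rfl⟩
        have h2 : p '' (J : Set ι) = insert (p j₀) (p '' (J.erase j₀ : Finset ι)) := by
          rw [← Set.image_insert_eq, ← Finset.coe_insert, Finset.insert_erase hj₀]
        rw [h2, Ideal.mem_span_insert] at h1
        obtain ⟨γ, z, hz, h3⟩ := h1
        exact ⟨γ, fun h => absurd h hi, by rw [h3, add_sub_cancel_left]; exact hz⟩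
    choose γ hγ1 hγ2 using hγ
    have hI : ∀ k, ∑ i, γ i * pderiv k (f i) ∈ HI H := by
      intro k
      refine hP _ ?_ (p j₀) (hpinv j₀) _ (hphom j₀).choose_spec _ ?_ (hJmin j₀ hj₀)
      · rintro _ ⟨i, _, rfl⟩
        exact ⟨hpinv i, hphom i⟩
      · have h1 := chain_rule (pderiv k) f h
        rw [h0, map_zero] at h1
        have h2 : p j₀ * ∑ i, γ i * pderiv k (f i) =
            - ∑ i, (p i - γ i * p j₀) * pderiv k (f i) := by
          simp only [sub_mul, Finset.sum_sub_distrib]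
          rw [← h1, Finset.mul_sum, zero_sub, neg_neg]
          exact Finset.sum_congr rfl (fun i _ => by ring)
        rw [h2, Ideal.neg_mem_iff]
        exact Ideal.sum_mem _ (fun i _ => Ideal.mul_mem_right _ _ (hγ2 i))
    set Q' := Ideal.span (f '' {j₀}ᶜ) with hQ'
    have hm : ∀ k, ∃ m : Pol n, constantCoeff m = 0 ∧
        X k * ∑ i, γ i * pderiv k (f i) - m * f j₀ ∈ Q' := by
      intro k
      have h1 := hI k
      have h2 : Set.range f = insert (f j₀) (f '' {j₀}ᶜ) := by
        rw [← Set.image_insert_eq, ← Set.image_univ]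
        congr 1
        ext x; by_cases hx : x = j₀ <;> simp [hx]
      rw [hspan, h2, Ideal.mem_span_insert] at h1
      obtain ⟨a, z, hz, h3⟩ := h1
      refine ⟨X k * a, by simp, ?_⟩
      rw [h3]
      have : X k * (a * f j₀ + z) - X k * a * f j₀ = X k * z := by ring
      rw [this]
      exact Ideal.mul_mem_left _ _ hz
    choose m hm0 hm1 using hm
    have h5 : (C (d j₀ : ℝ) - ∑ k, m k) * f j₀ ∈ Q' := by
      have h6 := Ideal.sum_mem Q' (fun k (_ : k ∈ Finset.univ) => hm1 k)
      rw [Finset.sum_sub_distrib, ← Finset.sum_mul] at h6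
      have h7 : ∑ k, X k * ∑ i, γ i * pderiv k (f i) = ∑ i, γ i * (C (d i : ℝ) * f i) := by
        simp only [Finset.mul_sum]
        rw [Finset.sum_comm]
        apply Finset.sum_congr rfl
        intro i _
        have h8 := (hf i).sum_X_mul_pderiv
        rw [← Nat.cast_smul_eq_nsmul ℝ, MvPolynomial.smul_eq_C_mul] at h8
        rw [← h8, Finset.mul_sum]
        exact Finset.sum_congr rfl (fun k _ => by ring)
      rw [h7, ← Finset.add_sum_erase _ _ (Finset.mem_univ j₀), hγ1 j₀ rfl] at h6
      have h9 : ∑ i ∈ Finset.univ.erase j₀, γ i * (C (d i : ℝ) * f i) ∈ Q' := by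
        apply Ideal.sum_mem
        intro i hi
        rw [← mul_assoc]
        exact Ideal.mul_mem_left _ _ (Ideal.subset_span ⟨i, by simpa using hi, rfl⟩)
      have h10 := Ideal.sub_mem _ h6 h9
      convert h10 using 1
      ring
    have h11 := hc_mem_span (T := f '' {j₀}ᶜ) (by rintro _ ⟨i, _, rfl⟩; exact ⟨_, hf i⟩) h5
      (d j₀ + 0)
    rw [mul_comm, hc_mul_add (hf j₀), homogeneousComponent_zero, ← constantCoeff_eq, map_sub,
      map_sum, Finset.sum_eq_zero (fun k _ => hm0 k), constantCoeff_C, sub_zero] at h11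
    apply hmin j₀
    have h12 := Ideal.mul_mem_right (C (d j₀ : ℝ)⁻¹) _ h11
    rwa [mul_assoc, ← C_mul, mul_inv_cancel₀, C_1, mul_one] at h12
    exact_mod_cast (hd j₀).ne'
  rw [algebraicIndependent_iff]
  intro h h0
  rw [← sum_weightedHomogeneousComponent d h]
  apply finsum_eq_zero_of_forall_eq_zero
  intro D
  apply key D _ (weightedHomogeneousComponent_isWeightedHomogeneous _ _)
  rw [← hc_aeval f d hf, h0, map_zero]

end gens



lemma orbit_poly (H : Subgroup (GLn n)) [Finite H] (a : Pol n) :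
    ∃ O : Finset (Pol n), a ∈ O ∧ (∀ c ∈ O, ∃ g ∈ H, c = act g a) ∧
      ∀ k, (∏ c ∈ O, (Polynomial.X - Polynomial.C c)).coeff k ∈ Inv H := by
  classical
  have := Fintype.ofFinite H
  let O : Finset (Pol n) := Finset.univ.image (fun g : H => act g.1 a)
  refine ⟨O, ?_, ?_, ?_⟩
  · rw [Finset.mem_image]
    exact ⟨1, Finset.mem_univ _, act_one a⟩
  · intro c hc
    rw [Finset.mem_image] at hc
    obtain ⟨g, -, rfl⟩ := hc
    exact ⟨g.1, g.2, rfl⟩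
  · intro k
    rw [mem_Inv]
    intro g hg
    have h1 : Polynomial.map (act g : Pol n →+* Pol n) (∏ c ∈ O, (Polynomial.X - Polynomial.C c)) =
        ∏ c ∈ O, (Polynomial.X - Polynomial.C c) := by
      rw [Polynomial.map_prod]
      refine Finset.prod_bij (fun c _ => act g c) ?_ ?_ ?_ ?_
      · intro c hc
        rw [Finset.mem_image] at hc ⊢
        obtain ⟨h, -, rfl⟩ := hc
        exact ⟨⟨g * h.1, H.mul_mem hg h.2⟩, Finset.mem_univ _, act_mul g h.1 a⟩
      · intro c _ c' _ h
        exact act_injective g h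
      · intro c hc
        rw [Finset.mem_image] at hc
        obtain ⟨h, -, rfl⟩ := hc
        refine ⟨act g⁻¹ (act h.1 a), ?_, act_act_inv _ _⟩
        rw [Finset.mem_image]
        exact ⟨⟨g⁻¹ * h.1, H.mul_mem (H.inv_mem hg) h.2⟩, Finset.mem_univ _, act_mul g⁻¹ h.1 a⟩
      · intro c _
        simp
    have h2 := congrArg (fun p => Polynomial.coeff p k) h1
    simpa [Polynomial.coeff_map] using h2

/-- The polynomial-algebra condition. -/
def PolyGens (H : Subgroup (GLn n)) (π : Fin n → Pol n) : Prop :=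
  AlgebraicIndependent ℝ π ∧ (∀ i, ∃ d, (π i).IsHomogeneous d) ∧
    (∀ i, π i ∈ Inv H) ∧ (∀ f ∈ Inv H, f ∈ Algebra.adjoin ℝ (Set.range π))

lemma isAlgebraic_adjoin (H : Subgroup (GLn n)) [Finite H] {ι : Type*} (f : ι → Pol n)
    (h : ∀ g ∈ Inv H, g ∈ Algebra.adjoin ℝ (Set.range f)) :
    Algebra.IsAlgebraic (Algebra.adjoin ℝ (Set.range f)) (Pol n) := by
  constructor
  intro a
  obtain ⟨O, haO, -, hO⟩ := orbit_poly H a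
  apply IsIntegral.isAlgebraic
  set F := ∏ c ∈ O, (Polynomial.X - Polynomial.C c) with hF
  have hmon : F.Monic := Polynomial.monic_prod_of_monic _ _ (fun c _ => Polynomial.monic_X_sub_C c)
  have hlift : F ∈ Polynomial.lifts (algebraMap (Algebra.adjoin ℝ (Set.range f)) (Pol n)) := by
    rw [Polynomial.lifts_iff_coeff_lifts]
    intro k
    exact ⟨⟨_, h _ (hO k)⟩, rfl⟩
  obtain ⟨q, hq, -, hqm⟩ := Polynomial.lifts_and_degree_eq_and_monic hlift hmon
  refine ⟨q, hqm, ?_⟩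
  rw [← Polynomial.eval_map, hq, hF, Polynomial.eval_prod]
  exact Finset.prod_eq_zero haO (by simp)

lemma polyGens_of_PP (H : Subgroup (GLn n)) [Finite H] (hP : PP H) : ∃ π, PolyGens H π := by
  classical
  have hfg : (HI H).FG := IsNoetherian.noetherian _
  obtain ⟨F, hFR, hF⟩ := (Submodule.fg_span_iff_fg_span_finset_subset (R := Pol n) (Rp H)).1 hfg
  obtain ⟨J, hJF, hJs, hJm⟩ := exists_min_gen (id : Pol n → Pol n) F
  have hJ : ∀ i : J, i.1 ∈ Inv H ∧ ∃ d, 0 < d ∧ i.1.IsHomogeneous d := fun i => hFR (hJF i.2)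
  choose d hd hf using fun i => (hJ i).2
  let f : J → Pol n := Subtype.val
  have hrange : Set.range f = (J : Set (Pol n)) := by
    simp [f]
  have hspan : HI H = Ideal.span (Set.range f) := by
    rw [hrange]
    simp only [Set.image_id] at hJs
    rw [hJs]
    exact hF
  have hmin : ∀ i, f i ∉ Ideal.span (f '' {i}ᶜ) := by
    intro i hi
    apply hJm i.1 i.2
    rw [Set.image_id]
    refine Ideal.span_mono ?_ hi
    rintro _ ⟨j, hj, rfl⟩
    simp only [Finset.coe_erase, Set.mem_sdiff, Finset.mem_coe, Set.mem_singleton_iff]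
    exact ⟨j.2, fun h => hj (Subtype.ext h)⟩
  have hgen := adjoin_of_gens H f d hd hf (fun i => (hJ i).1) hspan
  have hind := algIndep_of_gens H f d hP hd hf (fun i => (hJ i).1) hspan hmin
  have halg := isAlgebraic_adjoin H f hgen
  have htb : IsTranscendenceBasis ℝ f := hind.isTranscendenceBasis_iff_isAlgebraic.2 halg
  have hcard := htb.lift_cardinalMk_eq (IsTranscendenceBasis.mvPolynomial (Fin n) ℝ)
  have hcard2 : Fintype.card J = n := by
    simpa using hcard
  let e : Fin n ≃ J := (Fintype.equivFinOfCardEq hcard2).symm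
  refine ⟨f ∘ e, ?_, ?_, ?_, ?_⟩
  · exact hind.comp e e.injective
  · exact fun i => ⟨_, hf _⟩
  · exact fun i => (hJ _).1
  · rw [e.surjective.range_comp]
    exact hgen


lemma isReflection_of_rank_one {A : Matrix (Fin n) (Fin n) ℝ} (hne : A ≠ 1) (c l : Fin n → ℝ)
    (h : A - 1 = Matrix.vecMulVec c l) : IsReflection A := by
  refine ⟨hne, ?_⟩
  have h0 : Matrix.toLin' A - (LinearMap.id : (Fin n → ℝ) →ₗ[ℝ] Fin n → ℝ) =
      Matrix.toLin' (A - 1) := by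
    rw [map_sub, Matrix.toLin'_one]
  rw [h0]
  have h1 := LinearMap.finrank_range_add_finrank_ker (Matrix.toLin' (A - 1))
  have h2 : Module.finrank ℝ (LinearMap.range (Matrix.toLin' (A - 1))) ≤ 1 := by
    have := Matrix.rank_vecMulVec_le c l
    rw [← h] at this
    exact this
  have h3 : Module.finrank ℝ (LinearMap.range (Matrix.toLin' (A - 1))) ≠ 0 := by
    intro h4
    rw [Submodule.finrank_eq_zero, LinearMap.range_eq_bot] at h4
    apply hne
    rw [← sub_eq_zero]
    exact (map_eq_zero_iff _ Matrix.toLin'.injective).1 h4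
  simp only [Module.finrank_fin_fun] at h1
  omega

/-- The coordinate linear forms. -/
noncomputable def lin (n : ℕ) : (Fin n → ℝ) →ₗ[ℝ] Pol n where
  toFun v := ∑ i, v i • X i
  map_add' v w := by simp [add_smul, Finset.sum_add_distrib]
  map_smul' c v := by simp [Finset.smul_sum, mul_smul]

lemma lin_single (i : Fin n) : lin n (Pi.single i 1) = X i := by
  classical
  simp only [lin, LinearMap.coe_mk, AddHom.coe_mk]
  rw [Finset.sum_eq_single i]
  · simp
  · intro b _ hb; simp [hb]
  · simp

lemma exists_sub_mem (H' : Subgroup (GLn n)) [Finite H'] (g : GLn n) (P : Ideal (Pol n))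
    [P.IsPrime] (hall : ∀ b ∈ Inv H', act g b - b ∈ P) (a : Pol n) :
    ∃ h ∈ H', act g a - act h a ∈ P := by
  obtain ⟨O, haO, hO1, hO2⟩ := orbit_poly H' a
  set F := ∏ c ∈ O, (Polynomial.X - Polynomial.C c) with hF
  have h1 : F.eval a = 0 := by
    rw [hF, Polynomial.eval_prod]
    exact Finset.prod_eq_zero haO (by simp)
  have h2 : F.eval (act g a) ∈ P := by
    have h3 : F.eval (act g a) = F.eval (act g a) - act g (F.eval a) := by
      rw [h1, map_zero, sub_zero]
    rw [h3, Polynomial.eval_eq_sum_range, Polynomial.eval_eq_sum_range, map_sum,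
      ← Finset.sum_sub_distrib]
    apply Ideal.sum_mem
    intro k _
    rw [map_mul, map_pow, ← sub_mul]
    apply Ideal.mul_mem_right
    rw [← neg_sub]
    exact (Ideal.neg_mem_iff _).2 (hall _ (hO2 k))
  rw [hF, Polynomial.eval_prod, Ideal.IsPrime.prod_mem_iff] at h2
  obtain ⟨c, hc, hcP⟩ := h2
  obtain ⟨h, hh, rfl⟩ := hO1 c hc
  exact ⟨h, hh, by simpa using hcP⟩

lemma exists_sub_mem_all (H' : Subgroup (GLn n)) [Finite H'] (g : GLn n) (P : Ideal (Pol n))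
    [P.IsPrime] (hall : ∀ b ∈ Inv H', act g b - b ∈ P) :
    ∃ h ∈ H', ∀ i, act g (X i) - act h (X i) ∈ P := by
  let W : H' → Submodule ℝ (Fin n → ℝ) := fun h =>
    (P.restrictScalars ℝ).comap (((act g).toLinearMap - (act h.1).toLinearMap) ∘ₗ lin n)
  have hW : ∀ h v, v ∈ W h ↔ act g (lin n v) - act h.1 (lin n v) ∈ P := by
    intro h v
    simp [W]
  have hU : ⋃ h, (W h : Set (Fin n → ℝ)) = Set.univ := by
    rw [Set.eq_univ_iff_forall]
    intro v
    obtain ⟨h, hh, h1⟩ := exists_sub_mem H' g P hall (lin n v)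
    exact Set.mem_iUnion.2 ⟨⟨h, hh⟩, (hW _ _).2 h1⟩
  obtain ⟨h, hh⟩ := Subspace.exists_eq_top_of_iUnion_eq_univ hU
  refine ⟨h.1, h.2, fun i => ?_⟩
  rw [← lin_single]
  apply (hW _ _).1
  rw [hh]
  trivial

lemma exists_common (p : Pol n) (hp : ¬ IsUnit p) (f : Fin n → Pol n)
    (hf : ∀ i, (f i).IsHomogeneous 1) (hdvd : ∀ i, p ∣ f i) : ∃ c : Fin n → ℝ, ∀ i, f i = C (c i) * p := by
  have key : ∀ i, ∃ c : ℝ, f i = C c * p := by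
    intro i
    obtain ⟨q, hq⟩ := hdvd i
    by_cases h0 : f i = 0
    · exact ⟨0, by simp [h0]⟩
    · have hp0 : p ≠ 0 := by rintro rfl; exact h0 (by simpa using hq)
      have hq0 : q ≠ 0 := by rintro rfl; exact h0 (by simpa using hq)
      have h1 := (hf i).totalDegree h0
      rw [hq, totalDegree_mul_of_isDomain hp0 hq0] at h1
      have h2 : p.totalDegree ≠ 0 := by
        intro h3
        rw [totalDegree_eq_zero_iff_eq_C] at h3
        apply hp
        rw [h3]
        apply IsUnit.map
        rw [isUnit_iff_ne_zero]
        intro h4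
        rw [h4, C_0] at h3
        exact hp0 h3
      have h5 : q.totalDegree = 0 := by omega
      rw [totalDegree_eq_zero_iff_eq_C] at h5
      exact ⟨coeff 0 q, by rw [hq, mul_comm, ← h5]⟩
  choose c hc using key
  exact ⟨c, hc⟩

lemma sep (H H' : Subgroup (GLn n)) [Finite H'] (hle : H' ≤ H)
    (hrefl : ∀ g ∈ H, IsReflection (g : Matrix (Fin n) (Fin n) ℝ) → g ∈ H')
    (p : Pol n) (hp : (Ideal.span {p}).IsPrime) (g : GLn n) (hg : g ∈ H)
    (hall : ∀ b ∈ Inv H', act g b - b ∈ Ideal.span {p}) : g ∈ H' := by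
  classical
  obtain ⟨h, hh, h1⟩ := exists_sub_mem_all H' g _ hall
  have hpu : ¬ IsUnit p := by
    intro hu
    exact hp.ne_top (Ideal.span_singleton_eq_top.2 hu)
  obtain ⟨c, hc⟩ := exists_common p hpu (fun i => act g (X i) - act h (X i))
    (fun i => (act_X_isHomogeneous g i).sub (act_X_isHomogeneous h i))
    (fun i => Ideal.mem_span_singleton.1 (h1 i))
  set k := h⁻¹ * g with hk
  set A : Matrix (Fin n) (Fin n) ℝ := ↑k⁻¹ with hA
  set L := act h⁻¹ p with hL
  have h2 : ∀ i, act k (X i) - X i = C (c i) * L := by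
    intro i
    have h3 := congrArg (act h⁻¹) (hc i)
    rw [map_sub, ← act_mul, act_inv_act, map_mul (act h⁻¹) (C (c i)) p] at h3
    rw [hk, h3]
    congr 1
    exact (act h⁻¹).commutes _
  have h4 : A - 1 = Matrix.vecMulVec c (fun j => coeff (Finsupp.single j 1) L) := by
    ext i j
    have h5 := congrArg (coeff (Finsupp.single j 1)) (h2 i)
    have h6 : act k (X i) = ∑ j, A i j • (X j : Pol n) := polyAct_X _ _
    rw [h6, coeff_C_mul] at h5
    rw [Matrix.vecMulVec_apply, ← h5]
    simp [coeff_sum, coeff_X, Finsupp.single_left_inj, Matrix.one_apply]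
  have hkH' : k⁻¹ ∈ H' := by
    by_cases h1 : A = 1
    · have : k⁻¹ = 1 := Units.ext h1
      rw [this]; exact H'.one_mem
    · exact hrefl _ (H.inv_mem (H.mul_mem (H.inv_mem (hle hh)) hg)) (isReflection_of_rank_one h1 _ _ h4)
  have : g = h * k := by rw [hk, mul_inv_cancel_left]
  rw [this]
  exact H'.mul_mem hh (by simpa using H'.inv_mem hkH')


/-- Gradient of a polynomial. -/
noncomputable def grad (a : Pol n) : Fin n → Pol n := fun k => pderiv k a

lemma grad_add (a b : Pol n) : grad (a + b) = grad a + grad b := by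
  ext1 k; simp [grad]

lemma grad_smul (c : ℝ) (a : Pol n) : grad (c • a) = c • grad a := by
  ext1 k; simp [grad]

/-- Span of gradients of invariants. -/
noncomputable def NN (H : Subgroup (GLn n)) (π' : Fin n → Pol n) : Submodule (Pol n) (Fin n → Pol n) :=
  Submodule.span (Pol n) {v | ∃ r : Pol n, aeval π' r ∈ Inv H ∧ v = grad r}

lemma grad_eval (F : Polynomial (Pol n)) (a : Pol n) :
    grad (F.eval a) = (∑ i ∈ F.support, a ^ i • grad (F.coeff i)) + F.derivative.eval a • grad a := by
  ext1 k
  rw [Polynomial.eval_eq_sum, Polynomial.derivative_eval]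
  simp only [grad, Polynomial.sum, map_sum, Pi.add_apply, Finset.sum_apply, Pi.smul_apply,
    smul_eq_mul, Finset.sum_mul, ← Finset.sum_add_distrib]
  apply Finset.sum_congr rfl
  intro i _
  simp only [Derivation.leibniz, Derivation.leibniz_pow, smul_eq_mul, nsmul_eq_mul]
  ring

lemma D_lemma (H : Subgroup (GLn n)) [Finite H] (π' : Fin n → Pol n)
    (hind : AlgebraicIndependent ℝ π') (hrange : ∀ f ∈ Inv H, ∃ r : Pol n, aeval π' r = f)
    (P : Ideal (Pol n)) [hP : P.IsPrime] (a : Pol n)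
    (ha : ∀ g ∈ H, act g (aeval π' a) = aeval π' a ∨ act g (aeval π' a) - aeval π' a ∉ P) :
    ∃ u : Pol n, aeval π' u ∉ P ∧ u • grad a ∈ NN H π' := by
  classical
  have hinj : Function.Injective (aeval π' : Pol n →ₐ[ℝ] Pol n) := hind
  obtain ⟨O, haO, hO1, hO2⟩ := orbit_poly H (aeval π' a)
  set F := ∏ c ∈ O, (Polynomial.X - Polynomial.C c) with hF
  have hlift : F ∈ Polynomial.lifts ((aeval π' : Pol n →ₐ[ℝ] Pol n) : Pol n →+* Pol n) := by
    rw [Polynomial.lifts_iff_coeff_lifts]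
    intro k
    obtain ⟨r, hr⟩ := hrange _ (hO2 k)
    exact ⟨r, hr⟩
  obtain ⟨F0, hF0⟩ := (Polynomial.mem_lifts _).1 hlift
  have hev : ∀ G : Polynomial (Pol n), aeval π' (G.eval a) =
      (G.map ((aeval π' : Pol n →ₐ[ℝ] Pol n) : Pol n →+* Pol n)).eval (aeval π' a) := by
    intro G
    exact (Polynomial.eval_map_apply _ _).symm
  have h0 : F0.eval a = 0 := by
    apply hinj
    rw [map_zero, hev, hF0, hF, Polynomial.eval_prod]
    exact Finset.prod_eq_zero haO (by simp)
  refine ⟨F0.derivative.eval a, ?_, ?_⟩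
  · rw [hev, ← Polynomial.derivative_map, hF0, hF, ← Finset.mul_prod_erase _ _ haO,
      Polynomial.derivative_mul]
    simp only [Polynomial.derivative_X_sub_C, one_mul, Polynomial.eval_add, Polynomial.eval_mul,
      Polynomial.eval_sub, Polynomial.eval_X, Polynomial.eval_C, sub_self, zero_mul, add_zero,
      Polynomial.eval_prod]
    rw [Ideal.IsPrime.prod_mem_iff]
    rintro ⟨c, hc, hcP⟩
    rw [Finset.mem_erase] at hc
    obtain ⟨g, hg, rfl⟩ := hO1 c hc.2
    rcases ha g hg with h | h
    · exact hc.1 h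
    · apply h
      rw [← neg_sub]
      exact (Ideal.neg_mem_iff _).2 hcP
  · have h1 := grad_eval F0 a
    have hg0 : grad (0 : Pol n) = 0 := by ext1 k; simp [grad]
    rw [h0, hg0] at h1
    have h2 : F0.derivative.eval a • grad a = - ∑ i ∈ F0.support, a ^ i • grad (F0.coeff i) :=
      eq_neg_of_add_eq_zero_right h1.symm
    rw [h2]
    apply Submodule.neg_mem
    apply Submodule.sum_mem
    intro i _
    apply Submodule.smul_mem
    apply Submodule.subset_span
    refine ⟨_, ?_, rfl⟩
    have h3 := congrArg (fun p => Polynomial.coeff p i) hF0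
    simp only [Polynomial.coeff_map] at h3
    have h4 := hO2 i
    rw [← h3] at h4
    exact h4

lemma D_all (H H' : Subgroup (GLn n)) [Finite H] [Finite H'] (hle : H' ≤ H)
    (hrefl : ∀ g ∈ H, IsReflection (g : Matrix (Fin n) (Fin n) ℝ) → g ∈ H')
    (π' : Fin n → Pol n) (hπ' : PolyGens H' π') (p : Pol n) (hp : (Ideal.span {p}).IsPrime)
    (a : Pol n) : ∃ u : Pol n, aeval π' u ∉ Ideal.span {p} ∧ u • grad a ∈ NN H π' := by
  have hmemr : ∀ f ∈ Inv H', ∃ r : Pol n, aeval π' r = f := by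
    intro f hf
    have := hπ'.2.2.2 f hf
    rw [Algebra.adjoin_range_eq_range_aeval] at this
    exact this
  have hinv : ∀ r : Pol n, aeval π' r ∈ Inv H' := by
    intro r
    have h1 : aeval π' r ∈ Algebra.adjoin ℝ (Set.range π') := by
      rw [Algebra.adjoin_range_eq_range_aeval]
      exact ⟨r, rfl⟩
    refine (Algebra.adjoin_le ?_ : Algebra.adjoin ℝ (Set.range π') ≤ Inv H') h1
    rintro _ ⟨i, rfl⟩
    exact hπ'.2.2.1 i
  have hInv : ∀ f ∈ Inv H, f ∈ Inv H' := by
    intro f hf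
    rw [mem_Inv] at *
    exact fun g hg => hf g (hle hg)
  let D : Submodule ℝ (Pol n) :=
    { carrier := {a | ∃ u : Pol n, aeval π' u ∉ Ideal.span {p} ∧ u • grad a ∈ NN H π'}
      add_mem' := by
        rintro a b ⟨u, hu, hua⟩ ⟨v, hv, hvb⟩
        refine ⟨u * v, ?_, ?_⟩
        · rw [map_mul]
          exact fun h => (hp.mem_or_mem h).elim hu hv
        · rw [grad_add, smul_add]
          apply Submodule.add_mem
          · rw [mul_comm, mul_smul]
            exact Submodule.smul_mem _ _ hua
          · rw [mul_smul]
            exact Submodule.smul_mem _ _ hvb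
      zero_mem' := by
        refine ⟨1, ?_, ?_⟩
        · rw [map_one]
          exact fun h => hp.ne_top ((Ideal.eq_top_iff_one _).2 h)
        · have hg0 : grad (0 : Pol n) = 0 := by ext1 k; simp [grad]
          rw [hg0, smul_zero]
          exact Submodule.zero_mem _
      smul_mem' := by
        rintro c a ⟨u, hu, hua⟩
        refine ⟨u, hu, ?_⟩
        have : u • grad (c • a) = (C c : Pol n) • (u • grad a) := by
          ext1 k
          rw [grad_smul]
          simp only [Pi.smul_apply, smul_eq_mul, MvPolynomial.smul_eq_C_mul]
          ring
        rw [this]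
        exact Submodule.smul_mem _ _ hua }
  let κ := {g : H // g.1 ∉ H'}
  let W : Option κ → Submodule ℝ (Pol n) := fun o => o.elim D (fun g =>
    ((Ideal.span {p}).restrictScalars ℝ).comap
      (((act g.1.1).toLinearMap - LinearMap.id) ∘ₗ (aeval π' : Pol n →ₐ[ℝ] Pol n).toLinearMap))
  have hW : ∀ (g : κ) v, v ∈ W (some g) ↔
      act g.1.1 (aeval π' v) - aeval π' v ∈ Ideal.span {p} := by
    intro g v
    simp [W]
  have hU : ⋃ o, (W o : Set (Pol n)) = Set.univ := by
    rw [Set.eq_univ_iff_forall]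
    intro a
    by_cases h : ∃ g : κ, a ∈ W (some g)
    · obtain ⟨g, hg⟩ := h
      exact Set.mem_iUnion.2 ⟨some g, hg⟩
    · push Not at h
      refine Set.mem_iUnion.2 ⟨none, ?_⟩
      refine D_lemma H π' hπ'.1 (fun f hf => hmemr f (hInv f hf)) (Ideal.span {p}) a ?_
      intro g hg
      by_cases hgH : g ∈ H'
      · exact Or.inl (mem_Inv.1 (hinv a) g hgH)
      · right
        intro h1
        exact h ⟨⟨g, hg⟩, hgH⟩ ((hW _ _).2 h1)
  obtain ⟨o, ho⟩ := Subspace.exists_eq_top_of_iUnion_eq_univ hU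
  rcases o with _ | g
  · have : a ∈ W none := by rw [ho]; trivial
    exact this
  · exfalso
    apply g.2
    refine sep H H' hle hrefl p hp g.1.1 g.1.2 ?_
    intro b hb
    obtain ⟨r, rfl⟩ := hmemr b hb
    apply (hW _ _).1
    rw [ho]
    trivial


lemma jac_unit (H H' : Subgroup (GLn n)) [Finite H] [Finite H'] (hle : H' ≤ H)
    (hrefl : ∀ g ∈ H, IsReflection (g : Matrix (Fin n) (Fin n) ℝ) → g ∈ H')
    (π π' : Fin n → Pol n) (hπ : PolyGens H π) (hπ' : PolyGens H' π') (F : Fin n → Pol n)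
    (hF : ∀ i, aeval π' (F i) = π i) :
    ∃ c : ℝ, c ≠ 0 ∧ (Matrix.of fun i k => pderiv k (F i)).det = C c := by
  classical
  have hinj : Function.Injective (aeval π' : Pol n →ₐ[ℝ] Pol n) := hπ'.1
  set M : Matrix (Fin n) (Fin n) (Pol n) := Matrix.of fun i k => pderiv k (F i) with hM
  have hN : NN H π' ≤ Submodule.span (Pol n) (Set.range fun i => grad (F i)) := by
    rw [NN, Submodule.span_le]
    rintro _ ⟨r, hr, rfl⟩
    have h1 := hπ.2.2.2 _ hr
    rw [Algebra.adjoin_range_eq_range_aeval] at h1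
    obtain ⟨h, hh⟩ := h1
    have h2 : r = aeval F h := by
      apply hinj
      rw [← hh]
      have : (aeval π : Pol n →ₐ[ℝ] Pol n) = (aeval π').comp (aeval F) := by
        apply MvPolynomial.algHom_ext
        intro i
        rw [AlgHom.comp_apply, aeval_X, aeval_X, hF]
      change aeval π h = _
      rw [this]
      rfl
    have h3 : grad r = ∑ i, aeval F (pderiv i h) • grad (F i) := by
      ext1 k
      rw [h2, grad, chain_rule]
      simp [grad]
    rw [SetLike.mem_coe, h3]
    exact Submodule.sum_mem _ (fun i _ => Submodule.smul_mem _ _ (Submodule.subset_span ⟨i, rfl⟩))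
  have key : ∀ p : Pol n, (Ideal.span {p}).IsPrime → aeval π' M.det ∉ Ideal.span {p} := by
    intro p hp hmem
    have h1 : ∀ j : Fin n, ∃ (u : Pol n) (w : Fin n → Pol n), aeval π' u ∉ Ideal.span {p} ∧
        ∑ i, w i • grad (F i) = u • grad (X j) := by
      intro j
      obtain ⟨u, hu, h⟩ := D_all H H' hle hrefl π' hπ' p hp (X j)
      obtain ⟨w, hw⟩ := (Submodule.mem_span_range_iff_exists_fun _).1 (hN h)
      exact ⟨u, w, hu, hw⟩
    choose u w hu hw using h1
    have h2 : Matrix.of w * M = Matrix.diagonal u := by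
      ext1 j k
      have h3 := congrFun (hw j) k
      rw [Matrix.mul_apply, Matrix.diagonal_apply]
      simp only [Finset.sum_apply, Pi.smul_apply, grad, smul_eq_mul] at h3
      simp only [hM, Matrix.of_apply]
      rw [h3, pderiv_X, Pi.single_apply]
      split_ifs <;> simp_all
    have h3 := congrArg (aeval π') (congrArg Matrix.det h2)
    rw [Matrix.det_mul, Matrix.det_diagonal, map_mul, map_prod] at h3
    have h4 : ∏ i, aeval π' (u i) ∈ Ideal.span {p} := by
      rw [← h3]; exact Ideal.mul_mem_left _ _ hmem
    rw [Ideal.IsPrime.prod_mem_iff] at h4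
    obtain ⟨i, _, hi⟩ := h4
    exact hu i hi
  have hne : aeval π' M.det ≠ 0 := by
    intro h0
    refine key 0 ?_ ?_
    · rw [Ideal.span_singleton_eq_bot.2 rfl]
      exact Ideal.isPrime_bot
    · rw [h0]; exact Ideal.zero_mem _
  have hunit : IsUnit (aeval π' M.det) := by
    by_contra hnu
    obtain ⟨p, hp, hdvd⟩ := WfDvdMonoid.exists_irreducible_factor hnu hne
    exact key p ((Ideal.span_singleton_prime hp.ne_zero).2 hp.prime)
      (Ideal.mem_span_singleton.2 hdvd)
  obtain ⟨c, hc, h⟩ := MvPolynomial.isUnit_iff_eq_C_of_isReduced.1 hunit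
  refine ⟨c, hc.ne_zero, ?_⟩
  apply hinj
  rw [h, aeval_C]
  rfl

lemma coeff_single_pderiv (f : Pol n) (j : Fin n) :
    constantCoeff (pderiv j f) = coeff (Finsupp.single j 1) f := by
  rw [constantCoeff_eq, coeff_pderiv]
  simp

lemma degree_pos {π : Fin n → Pol n} (hind : AlgebraicIndependent ℝ π) (k : Fin n) {d : ℕ}
    (hd : (π k).IsHomogeneous d) : 0 < d := by
  rcases Nat.eq_zero_or_pos d with rfl | h
  · exfalso
    have hsC : π k = C (coeff 0 (π k)) := by
      rw [← totalDegree_eq_zero_iff_eq_C]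
      exact (totalDegree_zero_iff_isHomogeneous _).2 hd
    apply hind.transcendental k
    rw [hsC]
    exact isAlgebraic_algebraMap _
  · exact h

lemma Inv_le_of_gens (H H' : Subgroup (GLn n)) [Finite H] [Finite H'] (hle : H' ≤ H)
    (hrefl : ∀ g ∈ H, IsReflection (g : Matrix (Fin n) (Fin n) ℝ) → g ∈ H')
    (π π' : Fin n → Pol n) (hπ : PolyGens H π) (hπ' : PolyGens H' π') : Inv H' ≤ Inv H := by
  classical
  have hex : ∀ i, ∃ F : Pol n, aeval π' F = π i := by
    intro i
    have h1 : π i ∈ Inv H' := by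
      rw [mem_Inv]
      exact fun g hg => mem_Inv.1 (hπ.2.2.1 i) g (hle hg)
    have := hπ'.2.2.2 _ h1
    rw [Algebra.adjoin_range_eq_range_aeval] at this
    exact this
  choose F hF using hex
  obtain ⟨c, hc, hdet⟩ := jac_unit H H' hle hrefl π π' hπ hπ' F hF
  choose d hd using hπ'.2.1
  have hdpos : ∀ i, 0 < d i := fun i => degree_pos hπ'.1 i (hd i)
  let M0 : Matrix (Fin n) (Fin n) ℝ := Matrix.of fun i j => coeff (Finsupp.single j 1) (F i)
  have hM0 : M0.det = c := by
    have h1 := congrArg constantCoeff hdet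
    rw [RingHom.map_det, constantCoeff_C] at h1
    rw [← h1]
    congr 1
    ext i j
    simp [M0, coeff_single_pderiv]
  have hNM : M0⁻¹ * M0 = 1 := Matrix.nonsing_inv_mul _ (by rw [hM0]; exact hc.isUnit)
  have key : ∀ D, ∀ k, d k = D → π' k ∈ Inv H := by
    intro D
    induction D using Nat.strong_induction_on with
    | _ D ih =>
    intro k hk
    let E : Pol n := ∑ i, C (M0⁻¹ k i) * F i
    have hE1 : ∀ j, coeff (Finsupp.single j 1) E = if k = j then 1 else 0 := by
      intro j
      have h1 := congrFun (congrFun hNM k) j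
      rw [Matrix.mul_apply, Matrix.one_apply] at h1
      rw [← h1]
      simp [E, coeff_sum, M0]
    have hE2 : aeval π' E ∈ Inv H := by
      simp only [E, map_sum, map_mul, hF, aeval_C]
      exact Subalgebra.sum_mem _ (fun i _ => Subalgebra.mul_mem _ (Subalgebra.algebraMap_mem _ _)
        (hπ.2.2.1 i))
    have hE3 := hc_mem_Inv hE2 D
    rw [hc_aeval π' d hd] at hE3
    set E' := weightedHomogeneousComponent d D E with hE'
    have hdiff : aeval π' (E' - X k) ∈ Inv H := by
      rw [MvPolynomial.as_sum (E' - X k), map_sum]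
      apply Subalgebra.sum_mem
      intro m hm
      rw [mem_support_iff] at hm
      rw [aeval_monomial, Finsupp.prod_fintype _ _ (fun i => pow_zero _)]
      apply Subalgebra.mul_mem _ (Subalgebra.algebraMap_mem _ _)
      have hw : Finsupp.weight d m = D := by
        by_contra hne
        apply hm
        rw [coeff_sub, hE', coeff_weightedHomogeneousComponent, if_neg hne, coeff_X, if_neg, sub_zero]
        rintro rfl
        apply hne
        rw [Finsupp.weight_single]
        simpa using hk
      have hns : ∀ j, m ≠ Finsupp.single j 1 := by
        rintro j rfl
        apply hm
        rw [coeff_sub, hE', coeff_weightedHomogeneousComponent, if_pos hw, hE1, coeff_X]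
        simp [Finsupp.single_left_inj]
      apply Subalgebra.prod_mem
      intro j _
      by_cases hj : m j = 0
      · rw [hj, pow_zero]; exact Subalgebra.one_mem _
      · apply Subalgebra.pow_mem
        refine ih (d j) ?_ j rfl
        have h1 : Finsupp.single j 1 ≤ m := by
          rw [Finsupp.single_le_iff]; omega
        obtain ⟨m', rfl⟩ := exists_add_of_le h1
        have hm' : m' ≠ 0 := by
          rintro rfl
          exact hns j (by simp)
        have hnt : Finsupp.NonTorsionWeight ℕ d :=
          Finsupp.nonTorsionWeight_of ℕ d (fun i => (hdpos i).ne')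
        have h2 : Finsupp.weight d m' ≠ 0 := fun h0 =>
          hm' ((Finsupp.weight_eq_zero_iff_eq_zero d).1 h0)
        rw [map_add, Finsupp.weight_single] at hw
        simp only [one_smul] at hw
        omega
    have h5 := Subalgebra.sub_mem _ hE3 hdiff
    rw [← map_sub, sub_sub_cancel, aeval_X] at h5
    exact h5
  intro f hf
  refine (Algebra.adjoin_le ?_ : Algebra.adjoin ℝ (Set.range π') ≤ Inv H) (hπ'.2.2.2 f hf)
  rintro _ ⟨k, rfl⟩
  exact key _ k rfl

lemma refl_of_polyGens (H : Subgroup (GLn n)) [Finite H] (π : Fin n → Pol n) (hπ : PolyGens H π) :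
    H = Subgroup.closure {g : GLn n | g ∈ H ∧ IsReflection (g : Matrix (Fin n) (Fin n) ℝ)} := by
  set H' := Subgroup.closure {g : GLn n | g ∈ H ∧ IsReflection (g : Matrix (Fin n) (Fin n) ℝ)} with hH'
  have hle : H' ≤ H := (Subgroup.closure_le _).2 (fun g hg => hg.1)
  have hfin : Finite H' := Finite.of_injective _ (Subgroup.inclusion_injective hle)
  have hrefl : ∀ g ∈ H, IsReflection (g : Matrix (Fin n) (Fin n) ℝ) → g ∈ H' :=
    fun g hg hr => Subgroup.subset_closure ⟨hg, hr⟩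
  have hself : H' = Subgroup.closure {g : GLn n | g ∈ H' ∧ IsReflection (g : Matrix (Fin n) (Fin n) ℝ)} := by
    apply le_antisymm
    · conv_lhs => rw [hH']
      exact Subgroup.closure_mono (fun g hg => ⟨Subgroup.subset_closure hg, hg.2⟩)
    · exact (Subgroup.closure_le _).2 (fun g hg => hg.1)
  obtain ⟨π', hπ'⟩ := polyGens_of_PP H' (PP_of_reflection H' hself)
  have hI := Inv_le_of_gens H H' hle hrefl π π' hπ hπ'
  apply le_antisymm _ hle
  intro g hg
  refine sep H H' hle hrefl 0 ?_ g hg ?_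
  · rw [Ideal.span_singleton_eq_bot.2 rfl]
    exact Ideal.isPrime_bot
  · intro b hb
    rw [mem_Inv.1 (hI hb) g hg, sub_self]
    exact Ideal.zero_mem _

theorem main (H : Subgroup (GLn n)) [Finite H] :
    ((H = Subgroup.closure {g : GLn n | g ∈ H ∧ IsReflection (↑g : Matrix (Fin n) (Fin n) ℝ)}) ↔
      ∃ π, PolyGens H π) ∧ ((∃ π, PolyGens H π) ↔ Module.Free (Inv H) (Pol n)) := by
  refine ⟨⟨fun h => polyGens_of_PP H (PP_of_reflection H h), ?_⟩, ?_, ?_⟩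
  · rintro ⟨π, hπ⟩
    exact refl_of_polyGens H π hπ
  · rintro ⟨π, hπ⟩
    exact free_of_PP H (PP_of_reflection H (refl_of_polyGens H π hπ))
  · intro h
    exact polyGens_of_PP H (PP_of_free H h)


end STC

/-- **Shephard–Todd–Chevalley theorem.**  For a finite subgroup `H ⊆ GLₙ(ℝ)` the
following are equivalent: (1) `H` is generated by reflections; (2) the invariant ring
`ℝ[X]^H` is a polynomial algebra, generated by `n` algebraically independent homogeneous
invariants; (3) `ℝ[X]` is a free module over `ℝ[X]^H`. -/
theorem shephard_todd_chevalley {n : ℕ} (H : Subgroup (Matrix (Fin n) (Fin n) ℝ)ˣ)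
    [Finite H] :
    ((H = Subgroup.closure {g : (Matrix (Fin n) (Fin n) ℝ)ˣ |
        g ∈ H ∧ IsReflection (↑g : Matrix (Fin n) (Fin n) ℝ)}) ↔
      (∃ π : Fin n → MvPolynomial (Fin n) ℝ,
        AlgebraicIndependent ℝ π ∧
        (∀ i, ∃ d, (π i).IsHomogeneous d) ∧
        (∀ i, π i ∈ invariantSubalgebra H.subtype) ∧
        (∀ f ∈ invariantSubalgebra H.subtype, f ∈ Algebra.adjoin ℝ (Set.range π)))) ∧
    ((∃ π : Fin n → MvPolynomial (Fin n) ℝ,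
        AlgebraicIndependent ℝ π ∧
        (∀ i, ∃ d, (π i).IsHomogeneous d) ∧
        (∀ i, π i ∈ invariantSubalgebra H.subtype) ∧
        (∀ f ∈ invariantSubalgebra H.subtype, f ∈ Algebra.adjoin ℝ (Set.range π))) ↔
      Module.Free ↥(invariantSubalgebra H.subtype) (MvPolynomial (Fin n) ℝ)) := by
  exact STC.main H
end

section
/- Steinberg's theorem on the Jacobian: let G ⊆ GL_n(ℝ) be a finite real reflection group, let ψ_1, …, ψ_n be any set of fundamental invariants (algebraically independent homogeneous generators of ℝ[X_1, …, X_n]^G), and let Ψ : ℝ^n → ℝ^n be the map x ↦ (ψ_1(x), …, ψ_n(x)). Then Δ = c · det(Jac Ψ) for some nonzero constant c ∈ ℝ, where Δ := ∏ L_i is the product of the linear forms defining the reflection hyperplanes of G and Jac Ψ = (∂ψ_i/∂x_j)_{i,j} is the Jacobian matrix of Ψ. In particular, this holds for every choice of fundamental invariants. -/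
open MvPolynomial Matrix

set_option synthInstance.maxHeartbeats 1000000
set_option maxHeartbeats 1000000

/-- The action of an element `g` of a subgroup `H ⊆ GLₙ(ℝ)` on polynomials:
`f^g := f ∘ g⁻¹`. -/
noncomputable def subAct {n : ℕ} (H : Subgroup (Matrix (Fin n) (Fin n) ℝ)ˣ) (g : ↥H) :
    MvPolynomial (Fin n) ℝ →ₐ[ℝ] MvPolynomial (Fin n) ℝ :=
  polyAct ((((g⁻¹ : ↥H) : (Matrix (Fin n) (Fin n) ℝ)ˣ) : Matrix (Fin n) (Fin n) ℝ))

section helpers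

variable {n : ℕ}

/-- The linear form with coefficient vector `v`. -/
noncomputable def linF (n : ℕ) : (Fin n → ℝ) →ₗ[ℝ] MvPolynomial (Fin n) ℝ :=
  Fintype.linearCombination ℝ (fun j => (X j : MvPolynomial (Fin n) ℝ))

lemma linF_apply (v : Fin n → ℝ) : linF n v = ∑ j, v j • X j := by
  simp [linF, Fintype.linearCombination_apply]

lemma polyAct_X (M : Matrix (Fin n) (Fin n) ℝ) (i : Fin n) :
    polyAct M (X i) = linF n (M i) := by
  simp [polyAct, linF_apply]

lemma polyAct_linF (M : Matrix (Fin n) (Fin n) ℝ) (v : Fin n → ℝ) :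
    polyAct M (linF n v) = linF n (v ᵥ* M) := by
  rw [linF_apply, map_sum]
  simp_rw [map_smul, polyAct_X, ← map_smul, ← map_sum]
  congr 1
  ext j
  simp [Matrix.vecMul, dotProduct]

lemma pderiv_linF (v : Fin n → ℝ) (j : Fin n) : pderiv j (linF n v) = C (v j) := by
  classical
  rw [linF_apply, map_sum, Finset.sum_eq_single j]
  · simp [MvPolynomial.smul_eq_C_mul]
  · intro b _ hb
    simp [pderiv_X_of_ne hb]
  · simp

lemma eval_linF (v x : Fin n → ℝ) : eval x (linF n v) = v ⬝ᵥ x := by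
  simp [linF_apply, dotProduct, MvPolynomial.smul_eq_C_mul]

lemma linF_inj {v : Fin n → ℝ} (h : linF n v = 0) : v = 0 := by
  ext j
  have := pderiv_linF v j
  rw [h, map_zero] at this
  exact (C_eq_zero.mp this.symm)

lemma linF_hom (v : Fin n → ℝ) : (linF n v).IsHomogeneous 1 := by
  rw [linF_apply]
  refine IsHomogeneous.sum _ _ _ fun j _ => ?_
  rw [MvPolynomial.smul_eq_C_mul]
  simpa using (isHomogeneous_C (Fin n) (v j)).mul (isHomogeneous_X ℝ j)

lemma exists_linF {f : MvPolynomial (Fin n) ℝ} (hf : f.IsHomogeneous 1) :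
    ∃ v, f = linF n v := by
  have : f ∈ homogeneousSubmodule (Fin n) ℝ 1 := hf
  rw [homogeneousSubmodule_one_eq_span_X, Submodule.mem_span_range_iff_exists_fun] at this
  obtain ⟨c, hc⟩ := this
  exact ⟨c, by rw [linF_apply, hc]⟩

lemma linF_irr {v : Fin n → ℝ} (hv : v ≠ 0) : Irreducible (linF n v) := by
  have h0 : linF n v ≠ 0 := fun h => hv (linF_inj h)
  apply irreducible_of_totalDegree_eq_one ((linF_hom v).totalDegree h0)
  intro r hr
  obtain ⟨i, hi⟩ : ∃ i, v i ≠ 0 := by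
    by_contra! h
    exact hv (funext h)
  refine isUnit_iff_ne_zero.mpr fun hr0 => ?_
  subst hr0
  apply h0
  ext m
  simpa using hr m

lemma linF_prime {v : Fin n → ℝ} (hv : v ≠ 0) : Prime (linF n v) :=
  (linF_irr hv).prime

lemma linF_dvd {v w : Fin n → ℝ} (h : linF n v ∣ linF n w) : ∃ c : ℝ, w = c • v := by
  by_cases hw : w = 0
  · exact ⟨0, by simp [hw]⟩
  have hv : v ≠ 0 := by
    rintro rfl
    rw [map_zero, zero_dvd_iff] at h
    exact hw (linF_inj h)
  obtain ⟨u, hu⟩ := (linF_irr hv).associated_of_dvd (linF_irr hw) h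
  obtain ⟨c, -, hc⟩ := isUnit_iff_eq_C_of_isReduced.mp u.isUnit
  refine ⟨c, ?_⟩
  rw [← sub_eq_zero]
  apply linF_inj
  rw [map_sub, map_smul, ← hu, hc, MvPolynomial.smul_eq_C_mul]
  ring

/-- chain rule -/
lemma pderiv_polyAct (M : Matrix (Fin n) (Fin n) ℝ) (f : MvPolynomial (Fin n) ℝ) (j : Fin n) :
    pderiv j (polyAct M f) = ∑ i, polyAct M (pderiv i f) * C (M i j) := by
  classical
  induction f using MvPolynomial.induction_on with
  | C a => simp [polyAct]
  | add p q hp hq => simp only [map_add, hp, hq, add_mul, Finset.sum_add_distrib]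
  | mul_X p i hp =>
    rw [map_mul, Derivation.leibniz, hp, polyAct_X, pderiv_linF]
    simp only [Derivation.leibniz, smul_eq_mul, map_add, map_mul, add_mul, Finset.sum_add_distrib,
      polyAct_X, pderiv_X]
    congr 1
    · rw [Finset.sum_eq_single i]
      · simp
      · intro b _ hb
        simp [hb.symm]
      · simp
    · rw [Finset.mul_sum]
      exact Finset.sum_congr rfl fun _ _ => by ring

/-- the Jacobian determinant -/
noncomputable def jacD (ψ : Fin n → MvPolynomial (Fin n) ℝ) : MvPolynomial (Fin n) ℝ :=
  (Matrix.of fun i j : Fin n => MvPolynomial.pderiv j (ψ i)).det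

lemma jacD_act (M : Matrix (Fin n) (Fin n) ℝ) (ψ : Fin n → MvPolynomial (Fin n) ℝ)
    (h : ∀ i, polyAct M (ψ i) = ψ i) : jacD ψ = polyAct M (jacD ψ) * C M.det := by
  have e : (Matrix.of fun i j : Fin n => MvPolynomial.pderiv j (ψ i)) =
      ((polyAct M).mapMatrix (Matrix.of fun i j : Fin n => MvPolynomial.pderiv j (ψ i))) *
        (C : ℝ →+* MvPolynomial (Fin n) ℝ).mapMatrix M := by
    ext1 i j
    rw [Matrix.mul_apply, Matrix.of_apply, ← h i, pderiv_polyAct]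
    simp [h i]
  unfold jacD
  conv_lhs => rw [e]
  rw [Matrix.det_mul, AlgHom.map_det, RingHom.map_det]

/-- a polynomial is congruent to its image under a pseudo-reflection modulo the root -/
lemma dvd_sub_polyAct (M : Matrix (Fin n) (Fin n) ℝ) (w φ : Fin n → ℝ)
    (hM : ∀ i, M i = Pi.single i 1 + φ i • w) (f : MvPolynomial (Fin n) ℝ) :
    linF n w ∣ polyAct M f - f := by
  classical
  induction f using MvPolynomial.induction_on with
  | C a => simp [polyAct]
  | add p q hp hq =>
    rw [map_add, add_sub_add_comm]
    exact dvd_add hp hq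
  | mul_X p i hp =>
    have h1 : polyAct M (X i) = X i + φ i • linF n w := by
      rw [polyAct_X, hM, map_add, map_smul]
      congr 1
      rw [linF_apply, Finset.sum_eq_single i] <;> simp +contextual
    rw [map_mul, h1, MvPolynomial.smul_eq_C_mul]
    have : polyAct M p * (X i + C (φ i) * linF n w) - p * X i =
      (polyAct M p - p) * X i + linF n w * (polyAct M p * C (φ i)) := by ring
    rw [this]
    exact dvd_add (hp.mul_right _) (dvd_mul_right _ _)

/-- gradient -/
noncomputable def gradP (f : MvPolynomial (Fin n) ℝ) : Fin n → MvPolynomial (Fin n) ℝ :=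
  fun j => pderiv j f

lemma gradP_add (f g : MvPolynomial (Fin n) ℝ) : gradP (f + g) = gradP f + gradP g := by
  ext1 j; simp [gradP]

lemma gradP_mul (f g : MvPolynomial (Fin n) ℝ) : gradP (f * g) = f • gradP g + g • gradP f := by
  ext1 j; simp [gradP, Derivation.leibniz]

lemma gradP_pow (f : MvPolynomial (Fin n) ℝ) (k : ℕ) :
    gradP (f ^ k) = (k * f ^ (k - 1)) • gradP f := by
  ext1 j; simp [gradP, Derivation.leibniz_pow, mul_assoc]

lemma gradP_sum {ι : Type*} (s : Finset ι) (f : ι → MvPolynomial (Fin n) ℝ) :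
    gradP (∑ i ∈ s, f i) = ∑ i ∈ s, gradP (f i) := by
  ext1 j; simp [gradP]

lemma gradP_adjoin (ψ : Fin n → MvPolynomial (Fin n) ℝ) (f : MvPolynomial (Fin n) ℝ)
    (hf : f ∈ Algebra.adjoin ℝ (Set.range ψ)) :
    gradP f ∈ Submodule.span (MvPolynomial (Fin n) ℝ) (Set.range fun i => gradP (ψ i)) := by
  induction hf using Algebra.adjoin_induction with
  | mem x hx =>
    obtain ⟨i, rfl⟩ := hx
    exact Submodule.subset_span ⟨i, rfl⟩
  | algebraMap r =>
    have : gradP (algebraMap ℝ (MvPolynomial (Fin n) ℝ) r) = 0 := by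
      ext1 j; simp [gradP]
    rw [this]; exact Submodule.zero_mem _
  | add x y _ _ hx hy => rw [gradP_add]; exact Submodule.add_mem _ hx hy
  | mul x y _ _ hx hy =>
    rw [gradP_mul]
    exact Submodule.add_mem _ (Submodule.smul_mem _ _ hy) (Submodule.smul_mem _ _ hx)

lemma gradP_eval (W : Submodule (MvPolynomial (Fin n) ℝ) (Fin n → MvPolynomial (Fin n) ℝ))
    (F : Polynomial (MvPolynomial (Fin n) ℝ)) (hF : ∀ k, gradP (F.coeff k) ∈ W)
    (l : MvPolynomial (Fin n) ℝ) (hl : F.eval l = 0) :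
    (F.derivative.eval l) • gradP l ∈ W := by
  have h : gradP (F.eval l) =
      (∑ k ∈ F.support, l ^ k • gradP (F.coeff k)) + (F.derivative.eval l) • gradP l := by
    rw [Polynomial.eval_eq_sum, Polynomial.derivative_eval, Polynomial.sum_def,
      Polynomial.sum_def, gradP_sum, Finset.sum_smul, ← Finset.sum_add_distrib]
    refine Finset.sum_congr rfl fun k _ => ?_
    rw [gradP_mul, gradP_pow, add_comm, smul_smul, ← mul_assoc]
  have h0 : gradP (0 : MvPolynomial (Fin n) ℝ) = 0 := by ext1 j; simp [gradP]
  rw [hl, h0] at h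
  have : (F.derivative.eval l) • gradP l = -∑ k ∈ F.support, l ^ k • gradP (F.coeff k) := by
    rw [eq_neg_iff_add_eq_zero, add_comm]; exact h.symm
  rw [this]
  exact Submodule.neg_mem _ (Submodule.sum_mem _ fun k _ => Submodule.smul_mem _ _ (hF k))


/-- orbit of a covector under `H` -/
noncomputable def orbF (H : Subgroup (Matrix (Fin n) (Fin n) ℝ)ˣ) [Finite H] (v : Fin n → ℝ) :
    Finset (Fin n → ℝ) :=
  (Set.finite_range (fun g : H => v ᵥ* (g.1 : Matrix (Fin n) (Fin n) ℝ))).toFinset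

lemma mem_orbF (H : Subgroup (Matrix (Fin n) (Fin n) ℝ)ˣ) [Finite H] (v m : Fin n → ℝ) :
    m ∈ orbF H v ↔ ∃ g : H, v ᵥ* (g.1 : Matrix (Fin n) (Fin n) ℝ) = m := by
  simp [orbF]

lemma orbF_mul (H : Subgroup (Matrix (Fin n) (Fin n) ℝ)ˣ) [Finite H] (v m : Fin n → ℝ)
    (hm : m ∈ orbF H v) (g : H) : m ᵥ* (g.1 : Matrix (Fin n) (Fin n) ℝ) ∈ orbF H v := by
  rw [mem_orbF] at *
  obtain ⟨h, rfl⟩ := hm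
  exact ⟨h * g, by simp [Matrix.vecMul_vecMul]⟩

open Classical in
/-- orbit without the point itself -/
noncomputable def offF (H : Subgroup (Matrix (Fin n) (Fin n) ℝ)ˣ) [Finite H] (v : Fin n → ℝ) :
    Finset (Fin n → ℝ) := (orbF H v).erase v

lemma mem_offF (H : Subgroup (Matrix (Fin n) (Fin n) ℝ)ˣ) [Finite H] (v m : Fin n → ℝ) :
    m ∈ offF H v ↔ m ≠ v ∧ ∃ g : H, v ᵥ* (g.1 : Matrix (Fin n) (Fin n) ℝ) = m := by
  classical
  simp [offF, mem_orbF]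

/-- the derivative of the orbit polynomial at the linear form -/
noncomputable def dF (H : Subgroup (Matrix (Fin n) (Fin n) ℝ)ˣ) [Finite H] (v : Fin n → ℝ) :
    MvPolynomial (Fin n) ℝ := ∏ m ∈ offF H v, linF n (v - m)

lemma dF_grad (H : Subgroup (Matrix (Fin n) (Fin n) ℝ)ˣ) [Finite H]
    (ψ : Fin n → MvPolynomial (Fin n) ℝ)
    (hgen : ∀ f : MvPolynomial (Fin n) ℝ, (∀ g : ↥H, subAct H g f = f) →
      f ∈ Algebra.adjoin ℝ (Set.range ψ)) (v : Fin n → ℝ) :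
    dF H v • gradP (linF n v) ∈
      Submodule.span (MvPolynomial (Fin n) ℝ) (Set.range fun i => gradP (ψ i)) := by
  classical
  set F : Polynomial (MvPolynomial (Fin n) ℝ) :=
    ∏ m ∈ orbF H v, (Polynomial.X - Polynomial.C (linF n m)) with hF
  have hv : v ∈ orbF H v := (mem_orbF H v v).mpr ⟨1, by simp⟩
  have hF2 : F = (Polynomial.X - Polynomial.C (linF n v)) *
      ∏ m ∈ offF H v, (Polynomial.X - Polynomial.C (linF n m)) := by
    rw [hF, offF]
    exact (Finset.mul_prod_erase _ (fun m => Polynomial.X - Polynomial.C (linF n m)) hv).symm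
  have hd : F.derivative.eval (linF n v) = dF H v := by
    rw [hF2, Polynomial.derivative_mul]
    simp [dF, Polynomial.eval_prod]
  rw [← hd]
  apply gradP_eval
  · intro k
    apply gradP_adjoin
    apply hgen
    intro g
    have hmap : F.map (subAct H g : MvPolynomial (Fin n) ℝ →+* MvPolynomial (Fin n) ℝ) = F := by
      rw [hF, Polynomial.map_prod]
      refine Finset.prod_bij' (fun m _ => m ᵥ* ((g⁻¹ : H).1 : Matrix (Fin n) (Fin n) ℝ))
        (fun m _ => m ᵥ* (g.1 : Matrix (Fin n) (Fin n) ℝ)) ?_ ?_ ?_ ?_ ?_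
      · intro m hm; exact orbF_mul H v m hm _
      · intro m hm; exact orbF_mul H v m hm _
      · intro m hm
        simp only [Matrix.vecMul_vecMul, ← Units.val_mul, ← Subgroup.coe_mul]
        simp
      · intro m hm
        simp only [Matrix.vecMul_vecMul, ← Units.val_mul, ← Subgroup.coe_mul]
        simp
      · intro m hm
        rw [Polynomial.map_sub, Polynomial.map_X, Polynomial.map_C]
        congr 2
        exact polyAct_linF _ _
    conv_rhs => rw [← hmap]
    rw [Polynomial.coeff_map]
    rfl
  · rw [hF2]; simp

lemma jacD_dvd (H : Subgroup (Matrix (Fin n) (Fin n) ℝ)ˣ) [Finite H]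
    (ψ : Fin n → MvPolynomial (Fin n) ℝ)
    (hgen : ∀ f : MvPolynomial (Fin n) ℝ, (∀ g : ↥H, subAct H g f = f) →
      f ∈ Algebra.adjoin ℝ (Set.range ψ)) (b : Module.Basis (Fin n) ℝ (Fin n → ℝ)) :
    jacD ψ ∣ ∏ a, dF H (b a) := by
  have h := fun a => (Submodule.mem_span_range_iff_exists_fun _).mp (dF_grad H ψ hgen (b a))
  choose c hc using h
  have e : Matrix.of (fun a j => dF H (b a) * C (b a j)) =
      Matrix.of c * (Matrix.of fun i j : Fin n => MvPolynomial.pderiv j (ψ i)) := by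
    ext1 a j
    have := congrFun (hc a) j
    simp only [Finset.sum_apply, Pi.smul_apply, smul_eq_mul, gradP, pderiv_linF] at this
    rw [Matrix.mul_apply, Matrix.of_apply, ← this]
    rfl
  have e2 : Matrix.of (fun a j => dF H (b a) * C (b a j)) =
      Matrix.of (fun a j => dF H (b a) *
        ((C : ℝ →+* MvPolynomial (Fin n) ℝ).mapMatrix (Matrix.of fun a j => b a j)) a j) := by
    ext1 a j; simp
  have hu : IsUnit (Matrix.of fun a j => b a j).det := by
    rw [← Matrix.isUnit_iff_isUnit_det, ← Matrix.linearIndependent_rows_iff_isUnit]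
    exact b.linearIndependent
  have e3 := congrArg Matrix.det e
  rw [e2, Matrix.det_mul_column, Matrix.det_mul, ← RingHom.map_det] at e3
  have hu2 : IsUnit (C (Matrix.of fun a j => b a j).det : MvPolynomial (Fin n) ℝ) :=
    hu.map C
  rw [← hu2.dvd_mul_right, e3]
  exact dvd_mul_left _ _

lemma exists_form (H : Subgroup (Matrix (Fin n) (Fin n) ℝ)ˣ) [Finite H] :
    ∃ B : (Fin n → ℝ) →ₗ[ℝ] (Fin n → ℝ) →ₗ[ℝ] ℝ, (∀ v w, B v w = B w v) ∧
      (∀ v, v ≠ 0 → 0 < B v v) ∧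
      ∀ (g : H) v w, B (v ᵥ* (g.1 : Matrix (Fin n) (Fin n) ℝ))
        (w ᵥ* (g.1 : Matrix (Fin n) (Fin n) ℝ)) = B v w := by
  have := Fintype.ofFinite H
  refine ⟨LinearMap.mk₂ ℝ (fun v w => ∑ g : H, (v ᵥ* (g.1 : Matrix (Fin n) (Fin n) ℝ)) ⬝ᵥ
    (w ᵥ* (g.1 : Matrix (Fin n) (Fin n) ℝ))) ?_ ?_ ?_ ?_, ?_, ?_, ?_⟩
  · intro a b c; simp [Matrix.add_vecMul, add_dotProduct, Finset.sum_add_distrib]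
  · intro a b c; simp [Matrix.smul_vecMul, smul_dotProduct, Finset.mul_sum]
  · intro a b c; simp [Matrix.add_vecMul, dotProduct_add, Finset.sum_add_distrib]
  · intro a b c; simp [Matrix.smul_vecMul, dotProduct_smul, Finset.mul_sum]
  · intro v w
    simp only [LinearMap.mk₂_apply]
    exact Finset.sum_congr rfl fun _ _ => dotProduct_comm _ _
  · intro v hv
    simp only [LinearMap.mk₂_apply]
    have h0 : ∀ w : Fin n → ℝ, 0 ≤ w ⬝ᵥ w := fun w =>
      Finset.sum_nonneg fun i _ => mul_self_nonneg (w i)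
    refine Finset.sum_pos' (fun g _ => h0 _) ⟨1, Finset.mem_univ _, ?_⟩
    simp only [OneMemClass.coe_one, Units.val_one, Matrix.vecMul_one]
    exact lt_of_le_of_ne (h0 v) fun h => hv (dotProduct_self_eq_zero.mp h.symm)
  · intro g v w
    simp only [LinearMap.mk₂_apply, Matrix.vecMul_vecMul, ← Units.val_mul, ← Subgroup.coe_mul]
    exact Fintype.sum_equiv (Equiv.mulLeft g) _ _ fun _ => rfl

lemma exists_basis (B : (Fin n → ℝ) →ₗ[ℝ] (Fin n → ℝ) →ₗ[ℝ] ℝ) (v u : Fin n → ℝ)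
    (hu : B v u ≠ 0) :
    ∃ (b : Module.Basis (Fin n) ℝ (Fin n → ℝ)) (i : Fin n), b i = u ∧
      ∀ j, j ≠ i → B v (b j) = 0 := by
  have hf : B v ≠ 0 := fun h => hu (by simp [h])
  have h1 := Module.Dual.finrank_ker_add_one_of_ne_zero (K := ℝ) (f := B v) hf
  rw [Module.finrank_fin_fun] at h1
  obtain ⟨k, rfl⟩ : ∃ k, n = k + 1 := ⟨_, h1.symm⟩
  have h2 : Module.finrank ℝ (LinearMap.ker (B v)) = k := by omega
  let b0 := Module.finBasisOfFinrankEq ℝ (LinearMap.ker (B v)) h2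
  refine ⟨Module.Basis.mkFinCons u b0 ?_ ?_, 0, ?_, ?_⟩
  · intro c x hx h
    have := congrArg (B v) h
    rw [LinearMap.mem_ker] at hx
    simpa [hx, hu] using this
  · intro z
    refine ⟨-(B v z / B v u), ?_⟩
    rw [LinearMap.mem_ker]
    simp [hu]
  · simp [Module.Basis.coe_mkFinCons]
  · intro j hj
    obtain ⟨j', rfl⟩ := Fin.exists_succ_eq.mpr hj
    rw [Module.Basis.coe_mkFinCons]
    simp

lemma offF_orth (H : Subgroup (Matrix (Fin n) (Fin n) ℝ)ˣ) [Finite H]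
    (B : (Fin n → ℝ) →ₗ[ℝ] (Fin n → ℝ) →ₗ[ℝ] ℝ) (hs : ∀ v w, B v w = B w v)
    (hp : ∀ v, v ≠ 0 → 0 < B v v)
    (hi : ∀ (g : H) v w, B (v ᵥ* (g.1 : Matrix (Fin n) (Fin n) ℝ))
        (w ᵥ* (g.1 : Matrix (Fin n) (Fin n) ℝ)) = B v w) (v u m : Fin n → ℝ) (hv : v ≠ 0)
    (hm : m ∈ offF H u) (hd : linF n v ∣ linF n (u - m)) :
    B v u ≠ 0 ∧ m = u - (2 * B v u / B v v) • v := by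
  obtain ⟨c, hc⟩ := linF_dvd hd
  obtain ⟨hne, g, hg⟩ := (mem_offF H u m).mp hm
  have hm2 : m = u - c • v := by rw [← hc]; abel
  have hc0 : c ≠ 0 := by
    rintro rfl
    exact hne (by simpa using hm2)
  have h1 := hi g u u
  rw [hg, hm2] at h1
  simp only [map_sub, map_smul, LinearMap.sub_apply, LinearMap.smul_apply, smul_eq_mul,
    hs u v] at h1
  have hpv := hp v hv
  have h2 : c * (c * B v v - 2 * B v u) = 0 := by linarith
  have h3 : c * B v v = 2 * B v u := by
    rcases mul_eq_zero.mp h2 with h | h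
    · exact absurd h hc0
    · linarith
  constructor
  · intro h
    rw [h, mul_zero] at h3
    rcases mul_eq_zero.mp h3 with h | h
    · exact hc0 h
    · exact hpv.ne' h
  · rw [← h3, mul_div_assoc, div_self hpv.ne', mul_one]
    exact hm2

lemma linF_not_dvd_dF (H : Subgroup (Matrix (Fin n) (Fin n) ℝ)ˣ) [Finite H]
    (B : (Fin n → ℝ) →ₗ[ℝ] (Fin n → ℝ) →ₗ[ℝ] ℝ) (hs : ∀ v w, B v w = B w v)
    (hp : ∀ v, v ≠ 0 → 0 < B v v)
    (hi : ∀ (g : H) v w, B (v ᵥ* (g.1 : Matrix (Fin n) (Fin n) ℝ))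
        (w ᵥ* (g.1 : Matrix (Fin n) (Fin n) ℝ)) = B v w) (v u : Fin n → ℝ) (hv : v ≠ 0)
    (hu : B v u = 0) : ¬ linF n v ∣ dF H u := by
  intro h
  obtain ⟨m, hm, hd⟩ := (Prime.dvd_finsetProd_iff (linF_prime hv) _).mp h
  exact (offF_orth H B hs hp hi v u m hv hm hd).1 hu

lemma linF_sq_not_dvd_dF (H : Subgroup (Matrix (Fin n) (Fin n) ℝ)ˣ) [Finite H]
    (B : (Fin n → ℝ) →ₗ[ℝ] (Fin n → ℝ) →ₗ[ℝ] ℝ) (hs : ∀ v w, B v w = B w v)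
    (hp : ∀ v, v ≠ 0 → 0 < B v v)
    (hi : ∀ (g : H) v w, B (v ᵥ* (g.1 : Matrix (Fin n) (Fin n) ℝ))
        (w ᵥ* (g.1 : Matrix (Fin n) (Fin n) ℝ)) = B v w) (v u : Fin n → ℝ) (hv : v ≠ 0) :
    ¬ linF n v ^ 2 ∣ dF H u := by
  classical
  intro h
  have hpr := linF_prime hv
  obtain ⟨m, hm, hd⟩ := (Prime.dvd_finsetProd_iff hpr _).mp
    ((dvd_pow_self _ two_ne_zero).trans h)
  have hme := (offF_orth H B hs hp hi v u m hv hm hd).2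
  rw [dF, ← Finset.mul_prod_erase _ _ hm] at h
  have h2 : ¬ linF n v ∣ ∏ x ∈ (offF H u).erase m, linF n (u - x) := by
    intro h'
    obtain ⟨m', hm', hd'⟩ := (Prime.dvd_finsetProd_iff hpr _).mp h'
    rw [Finset.mem_erase] at hm'
    exact hm'.1 ((offF_orth H B hs hp hi v u m' hv hm'.2 hd').2.trans hme.symm)
  have h3 := hpr.pow_dvd_of_dvd_mul_right 2 h2 h
  have hne : u - m ≠ 0 := fun h0 => ((mem_offF H u m).mp hm).1 (sub_eq_zero.mp h0).symm
  rw [sq] at h3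
  exact hpr.not_isUnit ((linF_irr hne).squarefree _ h3)

lemma dF_ne_zero (H : Subgroup (Matrix (Fin n) (Fin n) ℝ)ˣ) [Finite H] (u : Fin n → ℝ) :
    dF H u ≠ 0 := by
  rw [dF, Finset.prod_ne_zero_iff]
  intro m hm h
  exact ((mem_offF H u m).mp hm).1 (sub_eq_zero.mp (linF_inj h)).symm

lemma prod_dF_split {v : Fin n → ℝ} (hv : v ≠ 0) (H : Subgroup (Matrix (Fin n) (Fin n) ℝ)ˣ)
    [Finite H]
    (B : (Fin n → ℝ) →ₗ[ℝ] (Fin n → ℝ) →ₗ[ℝ] ℝ) (hs : ∀ v w, B v w = B w v)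
    (hp : ∀ v, v ≠ 0 → 0 < B v v)
    (hi : ∀ (g : H) v w, B (v ᵥ* (g.1 : Matrix (Fin n) (Fin n) ℝ))
        (w ᵥ* (g.1 : Matrix (Fin n) (Fin n) ℝ)) = B v w) 
    (ψ : Fin n → MvPolynomial (Fin n) ℝ)
    (hgen : ∀ f : MvPolynomial (Fin n) ℝ, (∀ g : ↥H, subAct H g f = f) →
      f ∈ Algebra.adjoin ℝ (Set.range ψ)) (u : Fin n → ℝ) (hu : B v u ≠ 0) (k : ℕ)
    (hk : linF n v ^ k ∣ jacD ψ) : linF n v ^ k ∣ dF H u := by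
  classical
  obtain ⟨b, i, rfl, hb⟩ := exists_basis B v u hu
  have h := hk.trans (jacD_dvd H ψ hgen b)
  rw [← Finset.mul_prod_erase _ _ (Finset.mem_univ i)] at h
  refine (linF_prime hv).pow_dvd_of_dvd_mul_right k ?_ h
  intro h'
  obtain ⟨j, hj, hd⟩ := (Prime.dvd_finsetProd_iff (linF_prime hv) _).mp h'
  exact linF_not_dvd_dF H B hs hp hi v (b j) hv (hb j (Finset.ne_of_mem_erase hj)) hd

lemma exists_refl {v : Fin n → ℝ} (hv : v ≠ 0) (H : Subgroup (Matrix (Fin n) (Fin n) ℝ)ˣ)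
    [Finite H]
    (B : (Fin n → ℝ) →ₗ[ℝ] (Fin n → ℝ) →ₗ[ℝ] ℝ) (hs : ∀ v w, B v w = B w v)
    (hp : ∀ v, v ≠ 0 → 0 < B v v)
    (hi : ∀ (g : H) v w, B (v ᵥ* (g.1 : Matrix (Fin n) (Fin n) ℝ))
        (w ᵥ* (g.1 : Matrix (Fin n) (Fin n) ℝ)) = B v w)
    (ψ : Fin n → MvPolynomial (Fin n) ℝ)
    (hgen : ∀ f : MvPolynomial (Fin n) ℝ, (∀ g : ↥H, subAct H g f = f) →
      f ∈ Algebra.adjoin ℝ (Set.range ψ))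
    (hk : linF n v ∣ jacD ψ) :
    ∃ h : H, ∀ u, u ᵥ* (h.1 : Matrix (Fin n) (Fin n) ℝ) = u - (2 * B v u / B v v) • v := by
  let p : Option H → Subspace ℝ (Fin n → ℝ) := fun o => o.elim (LinearMap.ker (B v))
    (fun h => LinearMap.ker (Matrix.vecMulLinear (h.1 : Matrix (Fin n) (Fin n) ℝ) -
      (LinearMap.id - (2 / B v v) • (B v).smulRight v)))
  have hsome : ∀ h u, u ∈ p (some h) ↔ 
      u ᵥ* (h.1 : Matrix (Fin n) (Fin n) ℝ) = u - (2 * B v u / B v v) • v := by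
    intro h u
    simp only [p, Option.elim, LinearMap.mem_ker, LinearMap.sub_apply, sub_eq_zero (a := u ᵥ* _),
      Matrix.vecMulLinear_apply, LinearMap.smul_apply, LinearMap.smulRight_apply, LinearMap.id_apply,
      smul_smul]
    rw [div_mul_eq_mul_div]
  have hcov : ⋃ i, (p i : Set (Fin n → ℝ)) = Set.univ := by
    rw [Set.eq_univ_iff_forall]
    intro u
    rw [Set.mem_iUnion]
    by_cases hu : B v u = 0
    · exact ⟨none, hu⟩
    · have h1 := prod_dF_split hv H B hs hp hi ψ hgen u hu 1 (by rwa [pow_one])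
      rw [pow_one] at h1
      obtain ⟨m, hm, hd⟩ := (Prime.dvd_finsetProd_iff (linF_prime hv) _).mp h1
      have h2 := (offF_orth H B hs hp hi v u m hv hm hd).2
      obtain ⟨-, g, hg⟩ := (mem_offF H u m).mp hm
      exact ⟨some g, (hsome g u).mpr (hg.trans h2)⟩
  obtain ⟨o, ho⟩ := Subspace.exists_eq_top_of_iUnion_eq_univ hcov
  cases o with
  | none =>
    have : v ∈ p none := by rw [ho]; trivial
    exact absurd this (hp v hv).ne'
  | some h =>
    refine ⟨h, fun u => (hsome h u).mp ?_⟩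
    rw [ho]; trivial

lemma prop_of_ker {w z : Fin n → ℝ} (h : ∀ x, w ⬝ᵥ x = 0 → z ⬝ᵥ x = 0) : ∃ c : ℝ, z = c • w := by
  refine ⟨(w ⬝ᵥ z) / (w ⬝ᵥ w), ?_⟩
  set c := (w ⬝ᵥ z) / (w ⬝ᵥ w) with hc
  have h1 : w ⬝ᵥ (z - c • w) = 0 := by
    rw [dotProduct_sub, dotProduct_smul, smul_eq_mul, hc]
    by_cases hw : w ⬝ᵥ w = 0
    · have : w = 0 := dotProduct_self_eq_zero.mp hw
      simp [this]
    · field_simp; ring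
  have h2 := h _ h1
  have h3 : (z - c • w) ⬝ᵥ (z - c • w) = 0 := by
    conv_lhs => rw [sub_dotProduct, smul_dotProduct, h1, h2]
    simp
  exact sub_eq_zero.mp (dotProduct_self_eq_zero.mp h3)

lemma isRefl_of_form {v : Fin n → ℝ} (hv : v ≠ 0) (M : Matrix (Fin n) (Fin n) ℝ)
    (B : (Fin n → ℝ) →ₗ[ℝ] (Fin n → ℝ) →ₗ[ℝ] ℝ) (hp : ∀ v, v ≠ 0 → 0 < B v v)
    (hM : ∀ u, u ᵥ* M = u - (2 * B v u / B v v) • v) :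
    IsReflection M ∧ ∀ x, M *ᵥ x = x ↔ v ⬝ᵥ x = 0 := by
  have hvv := hp v hv
  have hvM : v ᵥ* M = -v := by
    rw [hM, mul_div_assoc, div_self hvv.ne', mul_one, two_smul]
    abel
  have hfix : ∀ x, M *ᵥ x = x ↔ v ⬝ᵥ x = 0 := by
    intro x
    constructor
    · intro h
      have : v ⬝ᵥ (M *ᵥ x) = v ⬝ᵥ x := by rw [h]
      rw [Matrix.dotProduct_mulVec, hvM, neg_dotProduct] at this
      linarith
    · intro h
      apply dotProduct_eq
      intro u
      rw [dotProduct_comm, dotProduct_comm x, Matrix.dotProduct_mulVec, hM, sub_dotProduct, smul_dotProduct, h]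
      simp
  refine ⟨⟨?_, ?_⟩, hfix⟩
  · rintro rfl
    rw [Matrix.vecMul_one] at hvM
    apply hv
    ext i
    have := congrFun hvM i
    simp only [Pi.neg_apply] at this
    simp only [Pi.zero_apply]
    linarith
  · let f : Module.Dual ℝ (Fin n → ℝ) := dotProductBilin ℝ ℝ v
    have hf : f ≠ 0 := by
      intro h
      have : f v = 0 := by rw [h]; rfl
      exact hv (dotProduct_self_eq_zero.mp this)
    have h1 := Module.Dual.finrank_ker_add_one_of_ne_zero hf
    rw [Module.finrank_fin_fun] at h1
    have : LinearMap.ker (Matrix.toLin' M - (LinearMap.id : (Fin n → ℝ) →ₗ[ℝ] Fin n → ℝ)) =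
        LinearMap.ker f := by
      ext x
      rw [LinearMap.mem_ker, LinearMap.mem_ker, LinearMap.sub_apply, Matrix.toLin'_apply,
        LinearMap.id_apply, sub_eq_zero, hfix]
      rfl
    rw [this]
    omega

lemma form_of_isRefl (H : Subgroup (Matrix (Fin n) (Fin n) ℝ)ˣ)
    (B : (Fin n → ℝ) →ₗ[ℝ] (Fin n → ℝ) →ₗ[ℝ] ℝ) (hs : ∀ v w, B v w = B w v)
    (hp : ∀ v, v ≠ 0 → 0 < B v v)
    (hi : ∀ (g : H) v w, B (v ᵥ* (g.1 : Matrix (Fin n) (Fin n) ℝ))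
        (w ᵥ* (g.1 : Matrix (Fin n) (Fin n) ℝ)) = B v w) (r : H)
    (h1 : (r.1 : Matrix (Fin n) (Fin n) ℝ) ≠ 1) (w : Fin n → ℝ)
    (hw : ∀ x, w ⬝ᵥ x = 0 ↔ (r.1 : Matrix (Fin n) (Fin n) ℝ) *ᵥ x = x) :
    w ≠ 0 ∧ ∀ u, u ᵥ* (r.1 : Matrix (Fin n) (Fin n) ℝ) = u - (2 * B w u / B w w) • w := by
  have hext : ∀ M : Matrix (Fin n) (Fin n) ℝ, (∀ u, u ᵥ* M = u) → M = 1 := by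
    intro M hM
    ext i j
    have := congrFun (hM (Pi.single i 1)) j
    rw [Matrix.single_one_vecMul] at this
    simpa [Pi.single_apply, Matrix.one_apply, eq_comm] using this
  have hphi : ∀ u, ∃ c : ℝ, u ᵥ* (r.1 : Matrix (Fin n) (Fin n) ℝ) - u = c • w := by
    intro u
    apply prop_of_ker
    intro x hx
    rw [sub_dotProduct, ← Matrix.dotProduct_mulVec, (hw x).mp hx, sub_self]
  choose φ hφ using hphi
  have hφ' : ∀ u, u ᵥ* (r.1 : Matrix (Fin n) (Fin n) ℝ) = u + φ u • w := fun u => by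
    rw [← hφ]; abel
  have hw0 : w ≠ 0 := by
    rintro rfl
    exact h1 (hext _ fun u => by simpa using hφ' u)
  refine ⟨hw0, ?_⟩
  have hww := hp w hw0
  have e1 := hi r w w
  have e2 := fun u => hi r u w
  simp only [hφ', map_add, map_smul, LinearMap.add_apply, LinearMap.smul_apply, smul_eq_mul]
    at e1 e2
  have e3 : φ w * (φ w + 2) * B w w = 0 := by linarith
  rcases mul_eq_zero.mp e3 with h | h
  swap
  · exact absurd h hww.ne'
  rcases mul_eq_zero.mp h with h | h
  · exfalso
    apply h1
    apply hext
    intro u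
    have := e2 u
    rw [h] at this
    have h4 : φ u * B w w = 0 := by linarith
    rcases mul_eq_zero.mp h4 with h5 | h5
    · rw [hφ', h5]; simp
    · exact absurd h5 hww.ne'
  · intro u
    have h4 : φ w = -2 := by linarith
    have := e2 u
    rw [h4, hs u w] at this
    rw [hφ', sub_eq_add_neg, ← neg_smul]
    congr 2
    field_simp
    linarith

lemma jacD_refl (M : Matrix (Fin n) (Fin n) ℝ) {w : Fin n → ℝ} (hw : w ≠ 0)
    (B : (Fin n → ℝ) →ₗ[ℝ] (Fin n → ℝ) →ₗ[ℝ] ℝ) (hp : ∀ v, v ≠ 0 → 0 < B v v)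
    (hM : ∀ u, u ᵥ* M = u - (2 * B w u / B w w) • w) (ψ : Fin n → MvPolynomial (Fin n) ℝ)
    (h : ∀ i, polyAct M (ψ i) = ψ i) : linF n w ∣ jacD ψ := by
  have hww := hp w hw
  let φ : Fin n → ℝ := fun i => -(2 * B w (Pi.single i 1) / B w w)
  have hφ : ∀ i, M i = Pi.single i 1 + φ i • w := by
    intro i
    have := hM (Pi.single i 1)
    rw [Matrix.single_one_vecMul] at this
    rw [neg_smul, ← sub_eq_add_neg]
    exact this
  have hB : ∑ i, w i * B w (Pi.single i 1) = B w w := by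
    have : w = ∑ i, w i • (Pi.single i 1 : Fin n → ℝ) := by
      ext j; simp [Finset.sum_apply, Pi.single_apply]
    conv_rhs => rw [this, map_sum, ← this]
    simp
  have hdet : M.det = -1 := by
    have e : M = 1 + Matrix.replicateCol Unit φ * Matrix.replicateRow Unit w := by
      ext i j
      rw [hφ i]
      simp [Matrix.mul_apply, Pi.single_apply, Matrix.one_apply, eq_comm]
    rw [e, Matrix.det_one_add_replicateCol_mul_replicateRow]
    have : w ⬝ᵥ φ = -2 := by
      have : w ⬝ᵥ φ = -(2 / B w w) * ∑ i, w i * B w (Pi.single i 1) := by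
        rw [Finset.mul_sum]
        exact Finset.sum_congr rfl fun i _ => by simp only [φ]; ring
      rw [this, hB]
      field_simp
    rw [this]; norm_num
  have hj := jacD_act M ψ h
  have hd := dvd_sub_polyAct M w φ hφ (jacD ψ)
  rw [hdet, map_neg, map_one, mul_neg, mul_one] at hj
  have h2 : polyAct M (jacD ψ) - jacD ψ = jacD ψ * C (-2) := by
    have : polyAct M (jacD ψ) = - jacD ψ := by
      rw [eq_neg_iff_add_eq_zero, add_comm, ← eq_neg_iff_add_eq_zero]; exact hj
    rw [this]
    have h22 : (C (-2) : MvPolynomial (Fin n) ℝ) = -2 := by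
      rw [map_neg]; rfl
    rw [h22]; ring
  rw [h2] at hd
  have hu : IsUnit (C (-2) : MvPolynomial (Fin n) ℝ) :=
    (isUnit_iff_ne_zero.mpr (by norm_num : (-2 : ℝ) ≠ 0)).map C
  exact hu.dvd_mul_right.mp hd

end helpers

/-- **Steinberg's theorem on the Jacobian of fundamental invariants.**
Let `H ⊆ GLₙ(ℝ)` be a finite real reflection group, `ψ_1, …, ψ_n` any set of fundamental
invariants, and `Δ = ∏ L_r` the product of the linear forms defining the reflection
hyperplanes of `H`.  Then `Δ = c · det(∂ψ_i/∂x_j)` for some nonzero constant `c ∈ ℝ`. -/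
theorem steinberg_jacobian {n : ℕ}
    (H : Subgroup (Matrix (Fin n) (Fin n) ℝ)ˣ) [Finite H]
    (hrefl : H = Subgroup.closure {g : (Matrix (Fin n) (Fin n) ℝ)ˣ |
      g ∈ H ∧ IsReflection (↑g : Matrix (Fin n) (Fin n) ℝ)})
    (ψ : Fin n → MvPolynomial (Fin n) ℝ)
    (hind : AlgebraicIndependent ℝ ψ)
    (hhom : ∀ i, ∃ d, 0 < d ∧ (ψ i).IsHomogeneous d)
    (hinv : ∀ i, ∀ g : ↥H, subAct H g (ψ i) = ψ i)
    (hgen : ∀ f : MvPolynomial (Fin n) ℝ, (∀ g : ↥H, subAct H g f = f) →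
      f ∈ Algebra.adjoin ℝ (Set.range ψ))
    (R : Finset (Matrix (Fin n) (Fin n) ℝ)ˣ)
    (hR : (R : Set (Matrix (Fin n) (Fin n) ℝ)ˣ) =
      {g : (Matrix (Fin n) (Fin n) ℝ)ˣ | g ∈ H ∧ IsReflection (↑g : Matrix (Fin n) (Fin n) ℝ)})
    (L : (Matrix (Fin n) (Fin n) ℝ)ˣ → MvPolynomial (Fin n) ℝ)
    (hL : ∀ r ∈ R, (L r).IsHomogeneous 1 ∧
      ∀ x : Fin n → ℝ, (MvPolynomial.eval x (L r) = 0 ↔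
        (↑r : Matrix (Fin n) (Fin n) ℝ) *ᵥ x = x))
    (Δ : MvPolynomial (Fin n) ℝ) (hΔ : Δ = ∏ r ∈ R, L r) :
    ∃ c : ℝ, c ≠ 0 ∧
      Δ = MvPolynomial.C c *
        (Matrix.of fun i j : Fin n => MvPolynomial.pderiv j (ψ i)).det := by
  classical
  obtain ⟨B, hs, hp, hi⟩ := exists_form H
  change ∃ c : ℝ, c ≠ 0 ∧ Δ = C c * jacD ψ
  have hRm : ∀ r, r ∈ R ↔ r ∈ H ∧ IsReflection (↑r : Matrix (Fin n) (Fin n) ℝ) := by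
    intro r
    rw [← Finset.mem_coe, hR]
    rfl
  -- normal form of the reflections and of their linear forms
  have hform : ∀ r ∈ R, ∃ w : Fin n → ℝ, L r = linF n w ∧ w ≠ 0 ∧
      ∀ u, u ᵥ* (r : Matrix (Fin n) (Fin n) ℝ) = u - (2 * B w u / B w w) • w := by
    intro r hr
    obtain ⟨hh, hx⟩ := hL r hr
    obtain ⟨w, hw⟩ := exists_linF hh
    obtain ⟨hrH, hrr⟩ := (hRm r).mp hr
    refine ⟨w, hw, form_of_isRefl H B hs hp hi ⟨r, hrH⟩ hrr.1 w fun x => ?_⟩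
    rw [← eval_linF, ← hw]
    exact hx x
  have hdvd : Δ ∣ jacD ψ := by
    rw [hΔ]
    apply Finset.prod_dvd_of_isRelPrime
    · intro r hr s hs' hne
      obtain ⟨w, hw, hw0, hwr⟩ := hform r hr
      obtain ⟨z, hz, hz0, hzs⟩ := hform s hs'
      change IsRelPrime (L r) (L s)
      rw [hw, hz, (linF_irr hw0).isRelPrime_iff_not_dvd]
      intro hd
      obtain ⟨c, rfl⟩ := linF_dvd hd
      have hc : c ≠ 0 := by
        rintro rfl
        simp at hz0
      have hww := (hp w hw0).ne'
      apply hne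
      apply Units.ext
      ext i j
      have e1 := congrFun (hwr (Pi.single i 1)) j
      have e2 := congrFun (hzs (Pi.single i 1)) j
      rw [Matrix.single_one_vecMul] at e1 e2
      change r.1 i j = _ at e1
      change s.1 i j = _ at e2
      rw [e1, e2]
      simp only [map_smul, LinearMap.smul_apply, smul_eq_mul, Pi.sub_apply, Pi.smul_apply]
      field_simp
    · intro r hr
      obtain ⟨w, hw, hw0, hwr⟩ := hform r hr
      rw [hw]
      refine jacD_refl _ hw0 B hp hwr ψ fun i => ?_
      have := hinv i (⟨r, ((hRm r).mp hr).1⟩⁻¹)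
      rw [subAct, inv_inv] at this
      exact this
  have hJ0 : jacD ψ ≠ 0 := by
    intro h0
    have := jacD_dvd H ψ hgen (Pi.basisFun ℝ (Fin n))
    rw [h0, zero_dvd_iff] at this
    exact (Finset.prod_ne_zero_iff.mpr fun a _ => dF_ne_zero H _) this
  obtain ⟨q, hq⟩ := hdvd
  have hq0 : q ≠ 0 := by
    rintro rfl
    exact hJ0 (by rw [hq, mul_zero])
  have hqu : IsUnit q := by
    by_contra hqn
    obtain ⟨p, hpi, hpq⟩ := WfDvdMonoid.exists_irreducible_factor hqn hq0
    have hpp : Prime p := hpi.prime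
    have hpJ : p ∣ jacD ψ := by rw [hq]; exact hpq.mul_left _
    -- `p` is a linear form
    obtain ⟨a, -, ha⟩ := (Prime.dvd_finsetProd_iff hpp _).mp
      (hpJ.trans (jacD_dvd H ψ hgen (Pi.basisFun ℝ (Fin n))))
    obtain ⟨m, hm, hd⟩ := (Prime.dvd_finsetProd_iff hpp _).mp ha
    obtain ⟨v, hv, hv0⟩ : ∃ v : Fin n → ℝ, Associated p (linF n v) ∧ v ≠ 0 := by
      have hne : Pi.basisFun ℝ (Fin n) a - m ≠ 0 := fun h0 =>
        ((mem_offF H _ m).mp hm).1 (sub_eq_zero.mp h0).symm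
      exact ⟨_, hpi.associated_of_dvd (linF_irr hne) hd, hne⟩
    have hvJ : linF n v ∣ jacD ψ := hv.symm.dvd.trans hpJ
    obtain ⟨h, hh⟩ := exists_refl hv0 H B hs hp hi ψ hgen hvJ
    obtain ⟨hr, hfix⟩ := isRefl_of_form hv0 _ B hp hh
    have hhR : h.1 ∈ R := (hRm _).mpr ⟨h.2, hr⟩
    obtain ⟨w, hw⟩ := exists_linF (hL h.1 hhR).1
    have hvL : linF n v ∣ L h.1 := by
      obtain ⟨c, hc⟩ : ∃ c : ℝ, w = c • v := by
        apply prop_of_ker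
        intro x hx
        rw [← eval_linF, ← hw]
        exact ((hL h.1 hhR).2 x).mpr ((hfix x).mpr hx)
      rw [hw, hc, map_smul, MvPolynomial.smul_eq_C_mul]
      exact dvd_mul_left _ _
    have hvD : linF n v ∣ Δ := by
      rw [hΔ]
      exact hvL.trans (Finset.dvd_prod_of_mem L hhR)
    have hsq : linF n v ^ 2 ∣ jacD ψ := by
      rw [hq, sq]
      exact mul_dvd_mul hvD (hv.symm.dvd.trans hpq)
    exact linF_sq_not_dvd_dF H B hs hp hi v v hv0
      (prod_dF_split hv0 H B hs hp hi ψ hgen v (hp v hv0).ne' 2 hsq)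
  obtain ⟨c, hc, rfl⟩ := isUnit_iff_eq_C_of_isReduced.mp hqu
  refine ⟨c⁻¹, inv_ne_zero hc.ne_zero, ?_⟩
  rw [hq, mul_comm Δ, ← mul_assoc, ← map_mul, inv_mul_cancel₀ hc.ne_zero, map_one, one_mul]
end
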